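/- arXiv:1704.01983 — 2 statements merged into one kernel-verified Lean document; each statement's English description precedes it below -/
import Mathlib

section
/- For every n, the wheel graph W_n contains no subgraph which is a Bad Configuration, for any placement of the two terminal pairs. -/
namespace NDG

variable {V : Type*} [DecidableEq V]

/-- A preliminary bad configuration (PBC) for the terminal pairs `(u,v)` and
`(w,x)`: the path `P_u = Lu ++ M ++ Ru` of one player and the path
`P_ℓ = Ll ++ M ++ Rl` of the other player meet exactly in the nonempty,
consistently oriented common subpath `M`; `q₁` closes a unique cycle with `P_u`
(intersecting it in the segment `S1`, which contains edges of `R_u` and of `M`),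
`q₂` and `q₃` close unique cycles with `P_ℓ` (intersecting it in the segments
`S2` resp. `S3`, containing edges of `L_ℓ` resp. `R_ℓ` and of `M`, and missing
part of `M`); moreover `C := C₂ ∩ C₃ ∩ M` is nonempty and contained in `C₁`, and
`(M ∩ C₁ ∩ C₂) \ C` and `(M ∩ C₁ ∩ C₃) \ C` each contain an edge. -/
structure PBC (G : SimpleGraph V) (u v w x : V) where
  a : V
  b : V
  Lu : G.Walk u a
  M : G.Walk a b
  Ru : G.Walk b v
  Ll : G.Walk w a
  Rl : G.Walk b x
  hM_ne : M.edges ≠ []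
  hPu : ((Lu.append M).append Ru).IsPath
  hPl : ((Ll.append M).append Rl).IsPath
  hforest : (SimpleGraph.fromEdgeSet
      {e | e ∈ ((Lu.append M).append Ru).edges ∨ e ∈ ((Ll.append M).append Rl).edges}).IsAcyclic
  hmeet : ∀ e, e ∈ ((Lu.append M).append Ru).edges →
      e ∈ ((Ll.append M).append Rl).edges → e ∈ M.edges
  hRu_ne : Ru.edges ≠ []
  hLl_ne : Ll.edges ≠ []
  hRl_ne : Rl.edges ≠ []
  a1 : V
  b1 : V
  q1 : G.Walk a1 b1
  S1 : G.Walk a1 b1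
  hq1path : q1.IsPath
  hq1_ne : q1.edges ≠ []
  hS1 : S1.darts <:+: ((Lu.append M).append Ru).darts
  hq1closes : ∀ y ∈ q1.support, y ∈ ((Lu.append M).append Ru).support → y = a1 ∨ y = b1
  hC1Ru : ∃ e ∈ S1.edges, e ∈ Ru.edges
  hC1M : ∃ e ∈ S1.edges, e ∈ M.edges
  a2 : V
  b2 : V
  q2 : G.Walk a2 b2
  S2 : G.Walk a2 b2
  hq2path : q2.IsPath
  hq2_ne : q2.edges ≠ []
  hS2 : S2.darts <:+: ((Ll.append M).append Rl).darts
  hq2closes : ∀ y ∈ q2.support, y ∈ ((Ll.append M).append Rl).support → y = a2 ∨ y = b2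
  hC2Ll : ∃ e ∈ S2.edges, e ∈ Ll.edges
  hC2M : ∃ e ∈ S2.edges, e ∈ M.edges
  hMC2 : ∃ e ∈ M.edges, e ∉ S2.edges
  a3 : V
  b3 : V
  q3 : G.Walk a3 b3
  S3 : G.Walk a3 b3
  hq3path : q3.IsPath
  hq3_ne : q3.edges ≠ []
  hS3 : S3.darts <:+: ((Ll.append M).append Rl).darts
  hq3closes : ∀ y ∈ q3.support, y ∈ ((Ll.append M).append Rl).support → y = a3 ∨ y = b3
  hC3Rl : ∃ e ∈ S3.edges, e ∈ Rl.edges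
  hC3M : ∃ e ∈ S3.edges, e ∈ M.edges
  hMC3 : ∃ e ∈ M.edges, e ∉ S3.edges
  hC_ne : ∃ e ∈ M.edges, e ∈ S2.edges ∧ e ∈ S3.edges
  hC_sub : ∀ e ∈ M.edges, e ∈ S2.edges → e ∈ S3.edges → e ∈ S1.edges
  hC1C2 : ∃ e ∈ M.edges, e ∈ S1.edges ∧ e ∈ S2.edges ∧ e ∉ S3.edges
  hC1C3 : ∃ e ∈ M.edges, e ∈ S1.edges ∧ e ∈ S3.edges ∧ e ∉ S2.edges

namespace PBC

variable {G : SimpleGraph V} {u v w x : V}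

/-- The path of the "upper" player (terminals `u`, `v`). -/
def Pu (B : PBC G u v w x) : G.Walk u v := (B.Lu.append B.M).append B.Ru

/-- The path of the "lower" player (terminals `w`, `x`). -/
def Pl (B : PBC G u v w x) : G.Walk w x := (B.Ll.append B.M).append B.Rl

/-- `q₁` is small: the cycle `C₁` contains no edge of `L_u`. -/
def Small (B : PBC G u v w x) : Prop := ∀ e ∈ B.S1.edges, e ∉ B.Lu.edges

/-- `q₁` is big: the cycle `C₁` contains an edge of `L_u`. -/
def Big (B : PBC G u v w x) : Prop := ∃ e ∈ B.S1.edges, e ∈ B.Lu.edges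

/-- Node-disjointness of two walks. -/
def NodeDisj {y z y' z' : V} (p : G.Walk y z) (q : G.Walk y' z') : Prop :=
  ∀ s ∈ p.support, s ∉ q.support

/-- `q` is internally node-disjoint from `P_u ∪ P_ℓ`. -/
def InternDisj (B : PBC G u v w x) {y z : V} (q : G.Walk y z) : Prop :=
  ∀ s ∈ q.support, s ≠ y → s ≠ z → s ∉ B.Pu.support ∧ s ∉ B.Pl.support

/-- The two walks intersect exactly in a common (possibly reversed) subpath. -/
def CommonMid {y z y' z' : V} (p : G.Walk y z) (q : G.Walk y' z') : Prop :=
  ∃ (c d : V) (m : G.Walk c d), m.IsPath ∧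
    m.darts <:+: p.darts ∧ (m.darts <:+: q.darts ∨ m.reverse.darts <:+: q.darts) ∧
    ∀ s, s ∈ p.support → s ∈ q.support → s ∈ m.support

/-- `q` contains no node of `L_u` or `R_u`. -/
def AvoidsUpperOuter (B : PBC G u v w x) {y z : V} (q : G.Walk y z) : Prop :=
  ∀ s ∈ q.support, s ∉ B.Lu.support ∧ s ∉ B.Ru.support

/-- In BC3/BC4, `q₁` avoids `R_ℓ` and the start node of `q₂`, and its initial
segment `α₁` (up to the last node contained in `L_ℓ`) runs inside the cycle
`C₂` along `L_ℓ`. -/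
def LlTraverse (B : PBC G u v w x) : Prop :=
  (∀ s ∈ B.q1.support, s ∉ B.Rl.support) ∧
  B.a2 ∉ B.q1.support ∧
  ∃ (y : V) (α : G.Walk B.a1 y) (β : G.Walk y B.b1),
    B.q1 = α.append β ∧ y ∈ B.Ll.support ∧
    (∀ e ∈ α.edges, e ∈ B.S2.edges) ∧
    (∀ s ∈ β.support, s ∈ B.Ll.support → s = y)

/-- Types BC1a (`q₁` small) and BC1b (`q₁` big): `q₁,q₂,q₃` pairwise
node-disjoint and internally node-disjoint from `P_u ∪ P_ℓ`. -/
def BC1 (B : PBC G u v w x) : Prop :=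
  NodeDisj B.q1 B.q2 ∧ NodeDisj B.q1 B.q3 ∧ NodeDisj B.q2 B.q3 ∧
  B.InternDisj B.q1 ∧ B.InternDisj B.q2 ∧ B.InternDisj B.q3

/-- Types BC2a–d: `q₃` node-disjoint with `q₁` and `q₂`; `q₁` and `q₂` overlap
exactly in a common subpath (`α₂ = β₂`); everything internally node-disjoint
from `P_u ∪ P_ℓ` (the subtypes corresponding to `q₁` small/big and the two
orientations of the common subpath are subsumed). -/
def BC2 (B : PBC G u v w x) : Prop :=
  NodeDisj B.q3 B.q1 ∧ NodeDisj B.q3 B.q2 ∧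
  ¬ NodeDisj B.q1 B.q2 ∧ CommonMid B.q1 B.q2 ∧
  B.InternDisj B.q1 ∧ B.InternDisj B.q2 ∧ B.InternDisj B.q3

/-- Type BC3. -/
def BC3 (B : PBC G u v w x) : Prop :=
  B.Small ∧ (∀ e ∈ B.M.edges, e ∈ B.S1.edges) ∧
  NodeDisj B.q1 B.q2 ∧ NodeDisj B.q1 B.q3 ∧ NodeDisj B.q2 B.q3 ∧
  B.AvoidsUpperOuter B.q2 ∧ B.AvoidsUpperOuter B.q3 ∧
  B.LlTraverse

/-- Types BC4a/b. -/
def BC4 (B : PBC G u v w x) : Prop :=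
  B.Small ∧ (∀ e ∈ B.M.edges, e ∈ B.S1.edges) ∧
  NodeDisj B.q3 B.q1 ∧ NodeDisj B.q3 B.q2 ∧
  ¬ NodeDisj B.q1 B.q2 ∧ CommonMid B.q1 B.q2 ∧
  B.AvoidsUpperOuter B.q2 ∧ B.AvoidsUpperOuter B.q3 ∧
  B.LlTraverse

/-- A PBC is a bad configuration if it is of one of the nine types
BC1a, BC1b, BC2a, BC2b, BC2c, BC2d, BC3, BC4a, BC4b. -/
def IsBC (B : PBC G u v w x) : Prop := B.BC1 ∨ B.BC2 ∨ B.BC3 ∨ B.BC4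

end PBC

/-- `(G,(s₁,t₁),(s₂,t₂))` contains a subgraph which is a bad configuration,
for some assignment of the terminal pairs to `(u,v)` and `(w,x)`. -/
def ContainsBC (G : SimpleGraph V) (s₁ t₁ s₂ t₂ : V) : Prop :=
  (∃ B : PBC G s₁ t₁ s₂ t₂, B.IsBC) ∨ (∃ B : PBC G s₁ t₁ t₂ s₂, B.IsBC) ∨
  (∃ B : PBC G t₁ s₁ s₂ t₂, B.IsBC) ∨ (∃ B : PBC G t₁ s₁ t₂ s₂, B.IsBC) ∨
  (∃ B : PBC G s₂ t₂ s₁ t₁, B.IsBC) ∨ (∃ B : PBC G s₂ t₂ t₁ s₁, B.IsBC) ∨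
  (∃ B : PBC G t₂ s₂ s₁ t₁, B.IsBC) ∨ (∃ B : PBC G t₂ s₂ t₁ s₁, B.IsBC)


/-- The wheel graph `W n`: the cycle on the vertices `some 0, …, some (n-1)`
together with the hub `none`, which is adjacent to all cycle vertices. -/
def wheelGraph (n : ℕ) : SimpleGraph (Option (Fin n)) :=
  SimpleGraph.fromRel fun p q =>
    p = none ∨ q = none ∨
    ∃ i j : Fin n, p = some i ∧ q = some j ∧ (i.val + 1) % n = j.val

namespace Aux

open SimpleGraph

variable {V : Type*}

/-- The graph `G` without the vertices `z`, `t` and the edge `xy`. -/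
def K (G : SimpleGraph V) (z t x y : V) : SimpleGraph V where
  Adj p q := G.Adj p q ∧ p ≠ z ∧ q ≠ z ∧ p ≠ t ∧ q ≠ t ∧ s(p, q) ≠ s(x, y)
  symm := ⟨fun p q h => ⟨h.1.symm, h.2.2.1, h.2.1, h.2.2.2.2.1, h.2.2.2.1, by
    rw [Sym2.eq_swap]; exact h.2.2.2.2.2⟩⟩
  loopless := ⟨fun p h => G.loopless.irrefl p h.1⟩

theorem reach_fun (H : SimpleGraph V) (f : ℕ → V) (i j : ℕ) (hij : i ≤ j)
    (h : ∀ k, i ≤ k → k < j → H.Adj (f k) (f (k + 1))) : H.Reachable (f i) (f j) := by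
  induction j, hij using Nat.le_induction with
  | base => exact Reachable.refl _
  | succ j hj ih =>
    exact (ih fun k h1 h2 => h k h1 (by omega)).trans (h j hj (by omega)).reachable

theorem inj {G : SimpleGraph V} {u v : V} {P : G.Walk u v} (hP : P.IsPath) {i j : ℕ}
    (hi : i ≤ P.length) (hj : j ≤ P.length) (h : P.getVert i = P.getVert j) : i = j :=
  hP.getVert_injOn hi hj h

theorem edge_inj {G : SimpleGraph V} {u v : V} {P : G.Walk u v} (hP : P.IsPath) {i j : ℕ}
    (hi : i < P.length) (hj : j < P.length)
    (h : s(P.getVert i, P.getVert (i + 1)) = s(P.getVert j, P.getVert (j + 1))) : i = j := by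
  rw [Sym2.eq_iff] at h
  rcases h with ⟨h, -⟩ | ⟨h, h'⟩
  · exact inj hP hi.le hj.le h
  · have := inj hP (by omega) (by omega) h
    have := inj hP (by omega) (by omega) h'
    omega

theorem mem_edges {G : SimpleGraph V} {u v : V} (P : G.Walk u v) (e : Sym2 V) :
    e ∈ P.edges ↔ ∃ k, k < P.length ∧ e = s(P.getVert k, P.getVert (k + 1)) := by
  induction P with
  | nil => simp
  | cons h p ih =>
    rw [Walk.edges_cons, List.mem_cons, ih]
    constructor
    · rintro (rfl | ⟨k, hk, rfl⟩)
      · exact ⟨0, by simp, by simp⟩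
      · exact ⟨k + 1, by simpa using hk, by simp⟩
    · rintro ⟨k, hk, rfl⟩
      cases k with
      | zero => left; simp
      | succ k => right; exact ⟨k, by simpa using hk, by simp⟩

theorem reach_walk {G : SimpleGraph V} {z t x y p r : V} (q : G.Walk p r)
    (hz : z ∉ q.support) (ht : t ∉ q.support) (hxy : x ∉ q.support ∨ y ∉ q.support) :
    (K G z t x y).Reachable p r := by
  have := reach_fun (K G z t x y) q.getVert 0 q.length (by omega) (by
    intro k _ hk
    have h1 := q.getVert_mem_support k
    have h2 := q.getVert_mem_support (k + 1)
    refine ⟨q.adj_getVert_succ hk, ?_, ?_, ?_, ?_, ?_⟩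
    · rintro rfl; exact hz h1
    · rintro rfl; exact hz h2
    · rintro rfl; exact ht h1
    · rintro rfl; exact ht h2
    · intro h
      rw [Sym2.eq_iff] at h
      rcases h with ⟨rfl, rfl⟩ | ⟨rfl, rfl⟩ <;> tauto)
  simpa using this

/-- Segments of a path. -/
theorem reach_seg {G : SimpleGraph V} {z t u v : V} {P : G.Walk u v} (hP : P.IsPath) (c : ℕ)
    (hc : c < P.length) (i j : ℕ) (hij : i ≤ j) (hj : j ≤ P.length)
    (hz : ∀ k, i ≤ k → k ≤ j → P.getVert k ≠ z) (ht : ∀ k, i ≤ k → k ≤ j → P.getVert k ≠ t)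
    (hcc : c < i ∨ j ≤ c) :
    (K G z t (P.getVert c) (P.getVert (c + 1))).Reachable (P.getVert i) (P.getVert j) := by
  apply reach_fun _ _ _ _ hij
  intro k h1 h2
  refine ⟨P.adj_getVert_succ (by omega), hz _ h1 (by omega), hz _ (by omega) (by omega),
    ht _ h1 (by omega), ht _ (by omega) (by omega), ?_⟩
  intro h
  have := edge_inj hP (by omega) hc h
  omega

/-- Infixes of a walk in terms of positions. -/
theorem infix_pos {G : SimpleGraph V} {u v a b : V} (P : G.Walk u v) (S : G.Walk a b)
    (hS : S.darts <:+: P.darts) (hne : S.edges ≠ []) :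
    ∃ i j, i < j ∧ j ≤ P.length ∧ a = P.getVert i ∧ b = P.getVert j ∧
      ∀ e, e ∈ S.edges ↔ ∃ k, i ≤ k ∧ k < j ∧ e = s(P.getVert k, P.getVert (k + 1)) := by
  obtain ⟨X, Y, h⟩ := hS
  have hl : X.length + S.length + Y.length = P.length := by
    have := congrArg List.length h
    simpa [add_assoc] using this
  have hpos : 0 < S.length := by
    rw [← Walk.length_edges]; exact List.length_pos_iff.2 hne
  have key : ∀ k, k < S.length → S.getVert k = P.getVert (X.length + k) ∧
      S.getVert (k + 1) = P.getVert (X.length + k + 1) := by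
    intro k hk
    have h1 : S.darts[k]'(by simpa using hk) = P.darts[X.length + k]'(by simp; omega) := by
      simp only [← h]
      grind
    rw [Walk.darts_getElem_eq_getVert, Walk.darts_getElem_eq_getVert] at h1
    have h2 := congrArg Dart.toProd h1
    simpa using h2
  refine ⟨X.length, X.length + S.length, by omega, by omega, ?_, ?_, ?_⟩
  · have := (key 0 hpos).1
    simpa using this
  · have := (key (S.length - 1) (by omega)).2
    rw [show S.length - 1 + 1 = S.length by omega,
      show X.length + (S.length - 1) + 1 = X.length + S.length by omega] at this
    simpa using this
  · intro e
    rw [mem_edges]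
    constructor
    · rintro ⟨k, hk, rfl⟩
      exact ⟨X.length + k, by omega, by omega, by rw [(key k hk).1, (key k hk).2]⟩
    · rintro ⟨k, h1, h2, rfl⟩
      refine ⟨k - X.length, by omega, ?_⟩
      have := key (k - X.length) (by omega)
      rw [this.1, this.2, show X.length + (k - X.length) = k by omega]

theorem core {G : SimpleGraph V} (z : V)
    (hbr : ∀ t x y, t ≠ z → G.Adj x y → x ≠ z → y ≠ z → x ≠ t → y ≠ t →
      ¬ (K G z t x y).Reachable x y)
    {u v w x : V} (Pu : G.Walk u v) (Pl : G.Walk w x) (hPu : Pu.IsPath) (hPl : Pl.IsPath)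
    (lu la m i1 j1 i2 j2 i3 j3 : ℕ)
    (hcom : ∀ k, k ≤ m → Pu.getVert (lu + k) = Pl.getVert (la + k))
    (h1 : i2 < la) (h2 : la < i3) (h3 : i3 < j2) (h4 : j2 < la + m) (h5 : la + m < j3)
    (h6 : j3 ≤ Pl.length) (h7 : i1 + la < lu + i3) (h8 : lu + m < j1) (h9 : j1 ≤ Pu.length)
    (q1 : G.Walk (Pu.getVert i1) (Pu.getVert j1))
    (q2 : G.Walk (Pl.getVert i2) (Pl.getVert j2))
    (q3 : G.Walk (Pl.getVert i3) (Pl.getVert j3))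
    (c1 : ∀ y ∈ q1.support, y ∈ Pu.support → y = Pu.getVert i1 ∨ y = Pu.getVert j1)
    (c2 : ∀ y ∈ q2.support, y ∈ Pl.support → y = Pl.getVert i2 ∨ y = Pl.getVert j2)
    (c3 : ∀ y ∈ q3.support, y ∈ Pl.support → y = Pl.getVert i3 ∨ y = Pl.getVert j3)
    (d13 : ∀ s ∈ q1.support, s ∉ q3.support) (d23 : ∀ s ∈ q2.support, s ∉ q3.support)
    (ha2 : Pl.getVert i2 ∉ q1.support) (ha2' : Pl.getVert i2 ∉ Pu.support)
    (hb3 : Pl.getVert j3 ∉ Pu.support) : False := by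
  have n1 : ∀ k, k ≤ Pu.length → k ≠ i1 → k ≠ j1 → Pu.getVert k ∉ q1.support := by
    intro k hk e1 e2 h
    rcases c1 _ h (Pu.getVert_mem_support k) with h | h
    · exact e1 (inj hPu hk (by omega) h)
    · exact e2 (inj hPu hk (by omega) h)
  have n2 : ∀ k, k ≤ Pl.length → k ≠ i2 → k ≠ j2 → Pl.getVert k ∉ q2.support := by
    intro k hk e1 e2 h
    rcases c2 _ h (Pl.getVert_mem_support k) with h | h
    · exact e1 (inj hPl hk (by omega) h)
    · exact e2 (inj hPl hk (by omega) h)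
  have n3 : ∀ k, k ≤ Pl.length → k ≠ i3 → k ≠ j3 → Pl.getVert k ∉ q3.support := by
    intro k hk e1 e2 h
    rcases c3 _ h (Pl.getVert_mem_support k) with h | h
    · exact e1 (inj hPl hk (by omega) h)
    · exact e2 (inj hPl hk (by omega) h)
  have nl : ∀ k k', k ≤ Pl.length → k' ≤ Pl.length → k ≠ k' → Pl.getVert k ≠ Pl.getVert k' :=
    fun k k' hk hk' hne h => hne (inj hPl hk hk' h)
  have nu : ∀ k k', k ≤ Pu.length → k' ≤ Pu.length → k ≠ k' → Pu.getVert k ≠ Pu.getVert k' :=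
    fun k k' hk hk' hne h => hne (inj hPu hk hk' h)
  have com' : ∀ k, la ≤ k → k ≤ la + m → Pl.getVert k = Pu.getVert (lu + k - la) := by
    intro k hk hk'
    have := hcom (k - la) (by omega)
    rw [show la + (k - la) = k by omega, show lu + (k - la) = lu + k - la by omega] at this
    exact this.symm
  -- the hub lies on `C₂`
  have hC2 : z ∈ q2.support ∨ ∃ k, i2 ≤ k ∧ k ≤ j2 ∧ Pl.getVert k = z := by
    by_contra hcon
    push Not at hcon
    obtain ⟨hz1, hz2⟩ := hcon
    obtain ⟨kt, hkt, hkt', htz⟩ : ∃ kt, j2 < kt ∧ kt ≤ Pl.length ∧ Pl.getVert kt ≠ z := by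
      by_cases hh : Pl.getVert (la + m) = z
      · exact ⟨j3, by omega, h6, hh ▸ nl _ _ (by omega) (by omega) (by omega)⟩
      · exact ⟨la + m, by omega, by omega, hh⟩
    refine hbr (Pl.getVert kt) (Pl.getVert i2) (Pl.getVert (i2 + 1)) htz
      (Pl.adj_getVert_succ (by omega)) (hz2 _ (by omega) (by omega)) (hz2 _ (by omega) (by omega))
      (nl _ _ (by omega) (by omega) (by omega)) (nl _ _ (by omega) (by omega) (by omega)) ?_
    refine (reach_walk q2 hz1 (n2 _ hkt' (by omega) (by omega))
      (Or.inr (n2 _ (by omega) (by omega) (by omega)))).trans (Reachable.symm ?_)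
    exact reach_seg hPl i2 (by omega) (i2 + 1) j2 (by omega) (by omega)
      (fun k _ _ => hz2 k (by omega) (by omega))
      (fun k _ _ => nl _ _ (by omega) (by omega) (by omega)) (by omega)
  have hC3 : z ∈ q3.support ∨ ∃ k, i3 ≤ k ∧ k ≤ j3 ∧ Pl.getVert k = z := by
    by_contra hcon
    push Not at hcon
    obtain ⟨hz1, hz2⟩ := hcon
    obtain ⟨kt, hkt, hkt', htz⟩ : ∃ kt, kt < i3 ∧ kt ≤ Pl.length ∧ Pl.getVert kt ≠ z := by
      by_cases hh : Pl.getVert la = z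
      · exact ⟨i2, by omega, by omega, hh ▸ nl _ _ (by omega) (by omega) (by omega)⟩
      · exact ⟨la, by omega, by omega, hh⟩
    refine hbr (Pl.getVert kt) (Pl.getVert i3) (Pl.getVert (i3 + 1)) htz
      (Pl.adj_getVert_succ (by omega)) (hz2 _ (by omega) (by omega)) (hz2 _ (by omega) (by omega))
      (nl _ _ (by omega) (by omega) (by omega)) (nl _ _ (by omega) (by omega) (by omega)) ?_
    refine (reach_walk q3 hz1 (n3 _ hkt' (by omega) (by omega))
      (Or.inr (n3 _ (by omega) (by omega) (by omega)))).trans (Reachable.symm ?_)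
    exact reach_seg hPl i3 (by omega) (i3 + 1) j3 (by omega) (by omega)
      (fun k _ _ => hz2 k (by omega) (by omega))
      (fun k _ _ => nl _ _ (by omega) (by omega) (by omega)) (by omega)
  -- hence on the common part
  obtain ⟨k, hk1, hk2, rfl⟩ : ∃ k, i3 ≤ k ∧ k ≤ j2 ∧ Pl.getVert k = z := by
    rcases hC2 with hA | ⟨k, hA1, hA2, hA3⟩ <;> rcases hC3 with hB | ⟨l, hB1, hB2, hB3⟩
    · exact absurd hB (d23 _ hA)
    · refine ⟨l, hB1, ?_, hB3⟩
      by_contra hl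
      exact n2 l (by omega) (by omega) (by omega) (hB3 ▸ hA)
    · refine ⟨k, ?_, hA2, hA3⟩
      by_contra hl
      exact n3 k (by omega) (by omega) (by omega) (hA3 ▸ hB)
    · have := inj hPl (by omega) (by omega) (hA3.trans hB3.symm)
      exact ⟨k, by omega, hA2, hA3⟩
  have hlu := hcom 0 (by omega)
  have hlum := hcom m (by omega)
  simp only [add_zero] at hlu
  have ek := com' k (by omega) (by omega)
  by_cases hkj : k < j2
  · -- the symmetric difference of `C₁` and `C₂`
    have ex := com' j2 (by omega) (by omega)
    have ey := com' (j2 + 1) (by omega) (by omega)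
    rw [show lu + (j2 + 1) - la = lu + j2 - la + 1 by omega] at ey
    have tu : ∀ i, Pu.getVert i ≠ Pl.getVert j3 := by
      intro i h; exact hb3 (h ▸ Pu.getVert_mem_support i)
    have t1 : Pl.getVert j3 ∉ q1.support := fun h => d13 _ h q3.end_mem_support
    have z1 : Pl.getVert k ∉ q1.support := by
      rw [ek]; exact n1 _ (by omega) (by omega) (by omega)
    refine hbr (Pl.getVert j3) (Pl.getVert j2) (Pl.getVert (j2 + 1))
      (nl _ _ (by omega) (by omega) (by omega))
      (Pl.adj_getVert_succ (by omega)) (nl _ _ (by omega) (by omega) (by omega))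
      (nl _ _ (by omega) (by omega) (by omega))
      (nl _ _ (by omega) (by omega) (by omega)) (nl _ _ (by omega) (by omega) (by omega)) ?_
    have r1 := (reach_walk (z := Pl.getVert k) (t := Pl.getVert j3) (x := Pl.getVert j2)
      (y := Pl.getVert (j2 + 1)) q2 (n2 _ (by omega) (by omega) (by omega))
      (n2 _ (by omega) (by omega) (by omega)) (Or.inr (n2 _ (by omega) (by omega) (by omega)))).symm
    have r2 := reach_seg (z := Pl.getVert k) (t := Pl.getVert j3) hPl j2 (by omega) i2 la
      (by omega) (by omega) (fun k _ _ => nl _ _ (by omega) (by omega) (by omega))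
      (fun k _ _ => nl _ _ (by omega) (by omega) (by omega)) (by omega)
    have r3 : (K G (Pl.getVert k) (Pl.getVert j3) (Pl.getVert j2)
        (Pl.getVert (j2 + 1))).Reachable (Pl.getVert la) (Pu.getVert i1) := by
      rw [ex, ey, ek, ← hlu]
      rcases le_total lu i1 with hle | hle
      · exact reach_seg hPu _ (by omega) lu i1 hle (by omega)
          (fun k _ _ => nu _ _ (by omega) (by omega) (by omega)) (fun k _ _ => tu k) (by omega)
      · exact (reach_seg hPu _ (by omega) i1 lu hle (by omega)
          (fun k _ _ => nu _ _ (by omega) (by omega) (by omega)) (fun k _ _ => tu k)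
          (by omega)).symm
    have r4 := reach_walk (z := Pl.getVert k) (t := Pl.getVert j3) (x := Pl.getVert j2)
      (y := Pl.getVert (j2 + 1)) q1 z1 t1
      (Or.inl (by rw [ex]; exact n1 _ (by omega) (by omega) (by omega)))
    have r5 : (K G (Pl.getVert k) (Pl.getVert j3) (Pl.getVert j2)
        (Pl.getVert (j2 + 1))).Reachable (Pl.getVert (j2 + 1)) (Pu.getVert j1) := by
      rw [ex, ey, ek]
      exact reach_seg hPu _ (by omega) _ j1 (by omega) (by omega)
          (fun k _ _ => nu _ _ (by omega) (by omega) (by omega)) (fun k _ _ => tu k) (by omega)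
    exact (((r1.trans r2).trans r3).trans r4).trans r5.symm
  · -- the symmetric difference of `C₁` and `C₃`
    obtain rfl : k = j2 := by omega
    obtain ⟨c, rfl⟩ : ∃ c, i3 = c + 1 := ⟨i3 - 1, by omega⟩
    have ex := com' c (by omega) (by omega)
    have ey := com' (c + 1) (by omega) (by omega)
    rw [show lu + (c + 1) - la = lu + c - la + 1 by omega] at ey
    have tu : ∀ i, Pu.getVert i ≠ Pl.getVert i2 := by
      intro i h; exact ha2' (h ▸ Pu.getVert_mem_support i)
    have z1 : Pl.getVert k ∉ q1.support := by
      rw [ek]; exact n1 _ (by omega) (by omega) (by omega)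
    refine hbr (Pl.getVert i2) (Pl.getVert c) (Pl.getVert (c + 1))
      (nl _ _ (by omega) (by omega) (by omega))
      (Pl.adj_getVert_succ (by omega)) (nl _ _ (by omega) (by omega) (by omega))
      (nl _ _ (by omega) (by omega) (by omega))
      (nl _ _ (by omega) (by omega) (by omega)) (nl _ _ (by omega) (by omega) (by omega)) ?_
    have r1 := reach_walk (z := Pl.getVert k) (t := Pl.getVert i2) (x := Pl.getVert c)
      (y := Pl.getVert (c + 1)) q3 (n3 _ (by omega) (by omega) (by omega))
      (n3 _ (by omega) (by omega) (by omega)) (Or.inl (n3 _ (by omega) (by omega) (by omega)))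
    have r2 := (reach_seg (z := Pl.getVert k) (t := Pl.getVert i2) hPl c (by omega) (la + m) j3
      (by omega) (by omega) (fun k _ _ => nl _ _ (by omega) (by omega) (by omega))
      (fun k _ _ => nl _ _ (by omega) (by omega) (by omega)) (by omega)).symm
    have r3 : (K G (Pl.getVert k) (Pl.getVert i2) (Pl.getVert c)
        (Pl.getVert (c + 1))).Reachable (Pl.getVert (la + m)) (Pu.getVert j1) := by
      rw [ex, ey, ek, ← hlum]
      exact reach_seg hPu _ (by omega) _ j1 (by omega) (by omega)
          (fun k _ _ => nu _ _ (by omega) (by omega) (by omega)) (fun k _ _ => tu k) (by omega)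
    have r4 := (reach_walk (z := Pl.getVert k) (t := Pl.getVert i2) (x := Pl.getVert c)
      (y := Pl.getVert (c + 1)) q1 z1 ha2
      (Or.inr (by rw [ey]; exact n1 _ (by omega) (by omega) (by omega)))).symm
    have r5 : (K G (Pl.getVert k) (Pl.getVert i2) (Pl.getVert c)
        (Pl.getVert (c + 1))).Reachable (Pu.getVert i1) (Pl.getVert c) := by
      rw [ex, ey, ek]
      exact reach_seg hPu _ (by omega) i1 _ (by omega) (by omega)
          (fun k _ _ => nu _ _ (by omega) (by omega) (by omega)) (fun k _ _ => tu k) (by omega)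
    exact ((((r1.trans r2).trans r3).trans r4).trans r5).symm

end Aux

namespace Aux

open SimpleGraph

theorem wheel_bridge (n : ℕ) (t x y : Option (Fin n)) (ht : t ≠ none)
    (hadj : (wheelGraph n).Adj x y) (hx : x ≠ none) (hy : y ≠ none) (hxt : x ≠ t) (hyt : y ≠ t) :
    ¬ (K (wheelGraph n) none t x y).Reachable x y := by
  obtain ⟨t, rfl⟩ := Option.ne_none_iff_exists'.1 ht
  have htn := t.2
  -- linear position on the rim, cut open at `t`
  let g : Fin n → ℕ := fun i => if t.val ≤ i.val then i.val - t.val else i.val + n - t.val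
  have ginj : ∀ i j, g i = g j → i = j := by
    intro i j h
    have := i.2
    have := j.2
    simp only [g] at h
    apply Fin.ext
    split_ifs at h <;> omega
  have gsucc : ∀ i j : Fin n, i ≠ t → j ≠ t → (i.val + 1) % n = j.val → g j = g i + 1 := by
    intro i j hi hj h
    have h1 := i.2
    have h2 := j.2
    have hi' : i.val ≠ t.val := fun h => hi (Fin.ext h)
    have hj' : j.val ≠ t.val := fun h => hj (Fin.ext h)
    have h3 : (i.val + 1 < n ∧ j.val = i.val + 1) ∨ (i.val + 1 = n ∧ j.val = 0) := by
      rcases Nat.lt_or_ge (i.val + 1) n with h4 | h4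
      · rw [Nat.mod_eq_of_lt h4] at h; omega
      · have h5 : i.val + 1 = n := by omega
        rw [h5, Nat.mod_self] at h; omega
    simp only [g]
    split_ifs <;> omega
  have gadj : ∀ i j : Fin n, i ≠ t → j ≠ t → (wheelGraph n).Adj (some i) (some j) →
      g j = g i + 1 ∨ g i = g j + 1 := by
    intro i j hi hj h
    simp only [wheelGraph, fromRel_adj] at h
    rcases h.2 with h | h
    · simp at h; left; exact gsucc i j hi hj h
    · simp at h; right; exact gsucc j i hj hi h
  have main : ∀ x y : Fin n, g y = g x + 1 →
      ¬ (K (wheelGraph n) none (some t) (some x) (some y)).Reachable (some x) (some y) := by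
    intro x y hxy hr
    have inv : ∀ p q, (K (wheelGraph n) none (some t) (some x) (some y)).Walk p q →
        (∃ i, p = some i ∧ g i ≤ g x) → ∃ i, q = some i ∧ g i ≤ g x := by
      intro p q w
      induction w with
      | nil => exact id
      | cons h w ih =>
        rintro ⟨i, rfl, hi⟩
        apply ih
        obtain ⟨h1, h2, h3, h4, h5, h6⟩ := h
        obtain ⟨j, rfl⟩ := Option.ne_none_iff_exists'.1 h3
        refine ⟨j, rfl, ?_⟩
        rcases gadj i j (fun h => h4 (by rw [h])) (fun h => h5 (by rw [h])) h1 with h | h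
        · by_contra hlt
          have e1 := ginj i x (by omega)
          have e2 := ginj j y (by omega)
          exact h6 (by rw [e1, e2])
        · omega
    obtain ⟨w⟩ := hr
    obtain ⟨i, h1, h2⟩ := inv _ _ w ⟨x, rfl, le_rfl⟩
    obtain rfl := Option.some.inj h1
    omega
  obtain ⟨x, rfl⟩ := Option.ne_none_iff_exists'.1 hx
  obtain ⟨y, rfl⟩ := Option.ne_none_iff_exists'.1 hy
  rcases gadj x y (fun h => hxt (by rw [h])) (fun h => hyt (by rw [h])) hadj with h | h
  · exact main x y h
  · intro hr
    refine main y x h (hr.symm.mono ?_)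
    rintro p q ⟨h1, h2, h3, h4, h5, h6⟩
    exact ⟨h1, h2, h3, h4, h5, by rw [Sym2.eq_swap (a := some y)]; exact h6⟩

/-- In the forest `P_u ∪ P_ℓ` the outer nodes of `P_ℓ` are not on `P_u`. -/
theorem forest_disj {V : Type*} {G : SimpleGraph V} {u v w x : V} (Pu : G.Walk u v)
    (Pl : G.Walk w x) (hPl : Pl.IsPath)
    (hF : (fromEdgeSet {e | e ∈ Pu.edges ∨ e ∈ Pl.edges}).IsAcyclic) (lu la m : ℕ)
    (hm : ∀ k, k < Pl.length → s(Pl.getVert k, Pl.getVert (k + 1)) ∈ Pu.edges →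
      la ≤ k ∧ k < la + m)
    (hcom : ∀ k, k ≤ m → Pu.getVert (lu + k) = Pl.getVert (la + k))
    (hll : la + m ≤ Pl.length) (hlu : lu + m ≤ Pu.length)
    (i : ℕ) (hi : i ≤ Pl.length) (hout : i < la ∨ la + m < i) :
    Pl.getVert i ∉ Pu.support := by
  intro hmem
  obtain ⟨c, hc, hcl⟩ := Walk.mem_support_iff_exists_getVert.1 hmem
  have key : ∀ e, e < Pl.length → (e < la ∨ la + m ≤ e) →
      (∀ i j, i ≤ j → j ≤ Pl.length → (e < i ∨ j ≤ e) →
        ((fromEdgeSet {e | e ∈ Pu.edges ∨ e ∈ Pl.edges}).deleteEdges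
          {s(Pl.getVert e, Pl.getVert (e + 1))}).Reachable (Pl.getVert i) (Pl.getVert j)) ∧
      (∀ i j, i ≤ j → j ≤ Pu.length →
        ((fromEdgeSet {e | e ∈ Pu.edges ∨ e ∈ Pl.edges}).deleteEdges
          {s(Pl.getVert e, Pl.getVert (e + 1))}).Reachable (Pu.getVert i) (Pu.getVert j)) ∧
      ¬ ((fromEdgeSet {e | e ∈ Pu.edges ∨ e ∈ Pl.edges}).deleteEdges
          {s(Pl.getVert e, Pl.getVert (e + 1))}).Reachable
          (Pl.getVert e) (Pl.getVert (e + 1)) := by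
    intro e he heo
    refine ⟨?_, ?_, ?_⟩
    · intro i j hij hj hei
      apply reach_fun _ _ _ _ hij
      intro k h1 h2
      rw [deleteEdges_adj, fromEdgeSet_adj]
      refine ⟨⟨Or.inr ((mem_edges _ _).2 ⟨k, by omega, rfl⟩),
        (Pl.adj_getVert_succ (by omega)).ne⟩, ?_⟩
      intro h
      have := edge_inj hPl (by omega) he h
      omega
    · intro i j hij hj
      apply reach_fun _ _ _ _ hij
      intro k h1 h2
      have hk : s(Pu.getVert k, Pu.getVert (k + 1)) ∈ Pu.edges :=
        (mem_edges _ _).2 ⟨k, by omega, rfl⟩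
      rw [deleteEdges_adj, fromEdgeSet_adj]
      refine ⟨⟨Or.inl hk, (Pu.adj_getVert_succ (by omega)).ne⟩, ?_⟩
      intro h
      rw [Set.mem_singleton_iff] at h
      rw [h] at hk
      have := hm e he hk
      omega
    · rw [← isBridge_iff]
      apply isAcyclic_iff_forall_adj_isBridge.1 hF
      rw [fromEdgeSet_adj]
      exact ⟨Or.inr ((mem_edges _ _).2 ⟨e, by omega, rfl⟩), (Pl.adj_getVert_succ he).ne⟩
  have h0 := hcom 0 (by omega)
  have h1 := hcom m le_rfl
  simp only [add_zero] at h0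
  rcases hout with ho | ho
  · obtain ⟨k1, k2, k3⟩ := key i (by omega) (Or.inl ho)
    apply k3
    have r1 := k1 (i + 1) la (by omega) (by omega) (by omega)
    have r2 : ((fromEdgeSet {e | e ∈ Pu.edges ∨ e ∈ Pl.edges}).deleteEdges
          {s(Pl.getVert i, Pl.getVert (i + 1))}).Reachable (Pu.getVert lu) (Pu.getVert c) := by
      rcases le_total lu c with h | h
      · exact k2 _ _ h hcl
      · exact (k2 _ _ h (by omega)).symm
    rw [h0, hc] at r2
    exact (r1.trans r2).symm
  · obtain ⟨i, rfl⟩ : ∃ j, i = j + 1 := ⟨i - 1, by omega⟩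
    obtain ⟨k1, k2, k3⟩ := key i (by omega) (Or.inr (by omega))
    apply k3
    have r1 := k1 (la + m) i (by omega) (by omega) (by omega)
    have r2 : ((fromEdgeSet {e | e ∈ Pu.edges ∨ e ∈ Pl.edges}).deleteEdges
          {s(Pl.getVert i, Pl.getVert (i + 1))}).Reachable (Pu.getVert (lu + m))
          (Pu.getVert c) := by
      rcases le_total (lu + m) c with h | h
      · exact k2 _ _ h hcl
      · exact (k2 _ _ h (by omega)).symm
    rw [h1, hc] at r2
    exact r1.symm.trans r2

/-- Positions in a walk split into three parts. -/
theorem parts {V : Type*} {G : SimpleGraph V} {u a b v : V} (L : G.Walk u a) (M : G.Walk a b)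
    (R : G.Walk b v) :
    ((L.append M).append R).length = L.length + M.length + R.length ∧
    (∀ k, k ≤ M.length → ((L.append M).append R).getVert (L.length + k) = M.getVert k) ∧
    (∀ e, e ∈ L.edges → ∃ k, k < L.length ∧
      e = s(((L.append M).append R).getVert k, ((L.append M).append R).getVert (k + 1))) ∧
    (∀ e, e ∈ R.edges → ∃ k, L.length + M.length ≤ k ∧ k < L.length + M.length + R.length ∧
      e = s(((L.append M).append R).getVert k, ((L.append M).append R).getVert (k + 1))) := by
  have hL : ∀ k, k ≤ L.length → ((L.append M).append R).getVert k = L.getVert k := by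
    intro k hk
    rw [Walk.getVert_append', if_pos (by rw [Walk.length_append]; omega), Walk.getVert_append',
      if_pos hk]
  have hR : ∀ k, ((L.append M).append R).getVert (L.length + M.length + k) = R.getVert k := by
    intro k
    rw [Walk.getVert_append, if_neg (by rw [Walk.length_append]; omega), Walk.length_append]
    congr 1; omega
  refine ⟨by simp [add_assoc], ?_, ?_, ?_⟩
  · intro k hk
    rw [Walk.getVert_append', if_pos (by rw [Walk.length_append]; omega), Walk.getVert_append,
      if_neg (by omega)]
    congr 1; omega
  · intro e he
    obtain ⟨k, hk, rfl⟩ := (mem_edges _ _).1 he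
    exact ⟨k, hk, by rw [hL k (by omega), hL (k + 1) (by omega)]⟩
  · intro e he
    obtain ⟨k, hk, rfl⟩ := (mem_edges _ _).1 he
    exact ⟨L.length + M.length + k, by omega, by omega, by
      rw [hR k, add_assoc (L.length + M.length), hR (k + 1)]⟩

theorem no_pbc {n : ℕ} {u v w x : Option (Fin n)} (B : PBC (wheelGraph n) u v w x)
    (d13 : ∀ s ∈ B.q1.support, s ∉ B.q3.support) (d23 : ∀ s ∈ B.q2.support, s ∉ B.q3.support)
    (hq : B.a2 ∉ B.q1.support ∨ B.InternDisj B.q1) : False := by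
  obtain ⟨lenu, mu, eLu, eRu⟩ := parts B.Lu B.M B.Ru
  obtain ⟨lenl, ml, eLl, eRl⟩ := parts B.Ll B.M B.Rl
  have hPu := B.hPu
  have hPl := B.hPl
  have hF := B.hforest
  have hmeet := B.hmeet
  have hS1 := B.hS1
  have hS2 := B.hS2
  have hS3 := B.hS3
  have c1 := B.hq1closes
  have c2 := B.hq2closes
  have c3 := B.hq3closes
  have hid : B.InternDisj B.q1 → ∀ s ∈ B.q1.support, s ≠ B.a1 → s ≠ B.b1 →
      s ∉ ((B.Ll.append B.M).append B.Rl).support := fun h s h1 h2 h3 => (h s h1 h2 h3).2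
  generalize (B.Lu.append B.M).append B.Ru = Pu at *
  generalize (B.Ll.append B.M).append B.Rl = Pl at *
  have ne_of : ∀ {a b : Option (Fin n)} (S : (wheelGraph n).Walk a b) (e : Sym2 (Option (Fin n))),
      e ∈ S.edges → S.edges ≠ [] := by
    intro a b S e he h; rw [h] at he; simp at he
  obtain ⟨e1, he1, he1'⟩ := B.hC1Ru
  obtain ⟨e2, he2, he2'⟩ := B.hC2Ll
  obtain ⟨e3, he3, he3'⟩ := B.hC3Rl
  obtain ⟨i1, j1, ij1, hj1, ea1, eb1, E1⟩ := infix_pos Pu B.S1 hS1 (ne_of _ _ he1)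
  obtain ⟨i2, j2, ij2, hj2, ea2, eb2, E2⟩ := infix_pos Pl B.S2 hS2 (ne_of _ _ he2)
  obtain ⟨i3, j3, ij3, hj3, ea3, eb3, E3⟩ := infix_pos Pl B.S3 hS3 (ne_of _ _ he3)
  -- edges of `M`
  have eM : ∀ e, e ∈ B.M.edges → ∃ k, k < B.M.length ∧
      e = s(Pl.getVert (B.Ll.length + k), Pl.getVert (B.Ll.length + k + 1)) ∧
      e = s(Pu.getVert (B.Lu.length + k), Pu.getVert (B.Lu.length + k + 1)) := by
    intro e he
    obtain ⟨k, hk, rfl⟩ := (mem_edges _ _).1 he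
    refine ⟨k, hk, ?_, ?_⟩
    · rw [add_assoc, ml k (by omega), ml (k + 1) (by omega)]
    · rw [add_assoc, mu k (by omega), mu (k + 1) (by omega)]
  have F1 : ∀ k, k < Pu.length → s(Pu.getVert k, Pu.getVert (k + 1)) ∈ B.S1.edges →
      i1 ≤ k ∧ k < j1 := by
    intro k hk h
    obtain ⟨k', h1, h2, h3⟩ := (E1 _).1 h
    have := edge_inj hPu hk (by omega) h3
    omega
  have F2 : ∀ k, k < Pl.length → (s(Pl.getVert k, Pl.getVert (k + 1)) ∈ B.S2.edges ↔
      i2 ≤ k ∧ k < j2) := by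
    intro k hk
    refine ⟨fun h => ?_, fun h => (E2 _).2 ⟨k, h.1, h.2, rfl⟩⟩
    obtain ⟨k', h1, h2, h3⟩ := (E2 _).1 h
    have := edge_inj hPl hk (by omega) h3
    omega
  have F3 : ∀ k, k < Pl.length → (s(Pl.getVert k, Pl.getVert (k + 1)) ∈ B.S3.edges ↔
      i3 ≤ k ∧ k < j3) := by
    intro k hk
    refine ⟨fun h => ?_, fun h => (E3 _).2 ⟨k, h.1, h.2, rfl⟩⟩
    obtain ⟨k', h1, h2, h3⟩ := (E3 _).1 h
    have := edge_inj hPl hk (by omega) h3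
    omega
  have g1 : i2 < B.Ll.length := by
    obtain ⟨k, hk, rfl⟩ := eLl _ he2'
    have := (F2 k (by omega)).1 he2
    omega
  have g2 : B.Ll.length + B.M.length < j3 := by
    obtain ⟨k, hk, hk', rfl⟩ := eRl _ he3'
    have := (F3 k (by omega)).1 he3
    omega
  have g3 : B.Lu.length + B.M.length < j1 := by
    obtain ⟨k, hk, hk', rfl⟩ := eRu _ he1'
    have := F1 k (by omega) he1
    omega
  have g4 : j2 < B.Ll.length + B.M.length := by
    obtain ⟨e, he, he'⟩ := B.hC2M
    obtain ⟨k, hk, rfl, -⟩ := eM _ he'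
    have h1 := (F2 _ (by omega)).1 he
    obtain ⟨e, he, he'⟩ := B.hMC2
    obtain ⟨k', hk', rfl, -⟩ := eM _ he
    rw [F2 _ (by omega)] at he'
    omega
  have g5 : B.Ll.length < i3 := by
    obtain ⟨e, he, he'⟩ := B.hMC3
    obtain ⟨k', hk', rfl, -⟩ := eM _ he
    rw [F3 _ (by omega)] at he'
    omega
  have g6 : i3 < j2 := by
    obtain ⟨e, he, he2, he3⟩ := B.hC_ne
    obtain ⟨k', hk', rfl, -⟩ := eM _ he
    rw [F2 _ (by omega)] at he2
    rw [F3 _ (by omega)] at he3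
    omega
  have g7 : i1 + B.Ll.length < B.Lu.length + i3 := by
    obtain ⟨e, he, he1, he2, he3⟩ := B.hC1C2
    obtain ⟨k, hk, rfl, h⟩ := eM _ he
    rw [F3 _ (by omega)] at he3
    rw [h] at he1
    have := F1 _ (by omega) he1
    omega
  have hcom : ∀ k, k ≤ B.M.length →
      Pu.getVert (B.Lu.length + k) = Pl.getVert (B.Ll.length + k) := by
    intro k hk
    rw [mu k hk, ml k hk]
  have hm : ∀ k, k < Pl.length → s(Pl.getVert k, Pl.getVert (k + 1)) ∈ Pu.edges →
      B.Ll.length ≤ k ∧ k < B.Ll.length + B.M.length := by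
    intro k hk h
    obtain ⟨k', hk', h', -⟩ := eM _ (hmeet _ h ((mem_edges _ _).2 ⟨k, hk, rfl⟩))
    have := edge_inj hPl hk (by omega) h'
    omega
  have D := forest_disj Pu Pl hPl hF _ _ _ hm hcom (by omega) (by omega)
  have D2 := D i2 (by omega) (by omega)
  have D3 := D j3 (by omega) (by omega)
  have ha2 : B.a2 ∉ B.q1.support := by
    rcases hq with h | h
    · exact h
    · intro hs
      refine hid h _ hs ?_ ?_ ?_
      · intro h'
        rw [← ea2, h', ea1] at D2
        exact D2 (Pu.getVert_mem_support _)
      · intro h'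
        rw [← ea2, h', eb1] at D2
        exact D2 (Pu.getVert_mem_support _)
      · rw [ea2]; exact Pl.getVert_mem_support _
  refine core none (fun t x y => wheel_bridge n t x y) Pu Pl hPu hPl B.Lu.length B.Ll.length
    B.M.length i1 j1 i2 j2 i3 j3 hcom g1 g5 g6 g4 g2 hj3 g7 g3 hj1
    (B.q1.copy ea1 eb1) (B.q2.copy ea2 eb2) (B.q3.copy ea3 eb3) ?_ ?_ ?_ ?_ ?_ ?_ D2 D3
  · rw [Walk.support_copy, ← ea1, ← eb1]; exact c1
  · rw [Walk.support_copy, ← ea2, ← eb2]; exact c2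
  · rw [Walk.support_copy, ← ea3, ← eb3]; exact c3
  · rw [Walk.support_copy, Walk.support_copy]; exact d13
  · rw [Walk.support_copy, Walk.support_copy]; exact d23
  · rw [Walk.support_copy, ← ea2]; exact ha2

theorem no_bc {n : ℕ} {u v w x : Option (Fin n)} (B : PBC (wheelGraph n) u v w x) :
    ¬ B.IsBC := by
  rintro (h | h | h | h)
  · obtain ⟨-, h13, h23, h1, -⟩ := h
    exact no_pbc B h13 h23 (Or.inr h1)
  · obtain ⟨h31, h32, -, -, h1, -⟩ := h
    exact no_pbc B (fun s h h' => h31 s h' h) (fun s h h' => h32 s h' h) (Or.inr h1)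
  · obtain ⟨-, -, -, h13, h23, -, -, h1⟩ := h
    exact no_pbc B h13 h23 (Or.inl h1.2.1)
  · obtain ⟨-, -, h31, h32, -, -, -, -, h1⟩ := h
    exact no_pbc B (fun s h h' => h31 s h' h) (fun s h h' => h32 s h' h) (Or.inl h1.2.1)

end Aux

/-- For every `n`, the wheel graph `W n` contains no
subgraph which is a bad configuration, for any placement of the two terminal
pairs. -/
theorem wheel_contains_no_bc (n : ℕ) (s₁ t₁ s₂ t₂ : Option (Fin n)) :
    ¬ ContainsBC (wheelGraph n) s₁ t₁ s₂ t₂ := by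
  rintro (⟨B, h⟩ | ⟨B, h⟩ | ⟨B, h⟩ | ⟨B, h⟩ | ⟨B, h⟩ | ⟨B, h⟩ | ⟨B, h⟩ | ⟨B, h⟩) <;>
    exact Aux.no_bc B h

end NDG
end

section
/- Every wheel graph W_n and every n-fan graph is strongly efficient for every placement of the terminal pairs (s_1,t_1),(s_2,t_2): for every nonnegative cost function, every optimal Steiner forest of the induced two-player network design game is enforceable. -/
namespace NDG

variable {V : Type*} [DecidableEq V]

/-- Total cost of a finite set of edges. -/
def cost (c : Sym2 V → ℝ) (F : Finset (Sym2 V)) : ℝ := ∑ e ∈ F, c e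

/-- A Steiner forest: an acyclic set of edges of `G` connecting both
terminal pairs. -/
def IsSteinerForest (G : SimpleGraph V) (s₁ t₁ s₂ t₂ : V) (F : Finset (Sym2 V)) : Prop :=
  (↑F ⊆ G.edgeSet) ∧
  (SimpleGraph.fromEdgeSet (↑F : Set (Sym2 V))).IsAcyclic ∧
  (∃ p : G.Walk s₁ t₁, p.IsPath ∧ ∀ e ∈ p.edges, e ∈ F) ∧
  (∃ p : G.Walk s₂ t₂, p.IsPath ∧ ∀ e ∈ p.edges, e ∈ F)

/-- An optimal Steiner forest: one of minimum total cost. -/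
def IsOptimalSteinerForest (G : SimpleGraph V) (s₁ t₁ s₂ t₂ : V) (c : Sym2 V → ℝ)
    (F : Finset (Sym2 V)) : Prop :=
  IsSteinerForest G s₁ t₁ s₂ t₂ F ∧
  ∀ F', IsSteinerForest G s₁ t₁ s₂ t₂ F' → cost c F ≤ cost c F'

/-- A strategy of a player: a simple path between her terminals. -/
abbrev Strat (G : SimpleGraph V) (s t : V) := {p : G.Walk s t // p.IsPath}

/-- A cost sharing protocol: cost shares for both players on every edge,
depending on the chosen strategy profile. -/
abbrev Protocol (G : SimpleGraph V) (s₁ t₁ s₂ t₂ : V) :=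
  Strat G s₁ t₁ → Strat G s₂ t₂ → Fin 2 → Sym2 V → ℝ

/-- The set of players using edge `e` in the profile `(P₁, P₂)`. -/
def usedBy {G : SimpleGraph V} {s₁ t₁ s₂ t₂ : V}
    (P₁ : Strat G s₁ t₁) (P₂ : Strat G s₂ t₂) (e : Sym2 V) : Finset (Fin 2) :=
  (if e ∈ P₁.1.edges then {0} else ∅) ∪ (if e ∈ P₂.1.edges then {1} else ∅)

/-- The total cost player 1 pays. -/
def cost₁ {G : SimpleGraph V} {s₁ t₁ s₂ t₂ : V} (Ξ : Protocol G s₁ t₁ s₂ t₂)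
    (P₁ : Strat G s₁ t₁) (P₂ : Strat G s₂ t₂) : ℝ :=
  ∑ e ∈ P₁.1.edges.toFinset, Ξ P₁ P₂ 0 e

/-- The total cost player 2 pays. -/
def cost₂ {G : SimpleGraph V} {s₁ t₁ s₂ t₂ : V} (Ξ : Protocol G s₁ t₁ s₂ t₂)
    (P₁ : Strat G s₁ t₁) (P₂ : Strat G s₂ t₂) : ℝ :=
  ∑ e ∈ P₂.1.edges.toFinset, Ξ P₁ P₂ 1 e

/-- Pure Nash equilibrium of the two-player game induced by the protocol `Ξ`. -/
def IsPNE {G : SimpleGraph V} {s₁ t₁ s₂ t₂ : V} (Ξ : Protocol G s₁ t₁ s₂ t₂)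
    (P₁ : Strat G s₁ t₁) (P₂ : Strat G s₂ t₂) : Prop :=
  (∀ Q₁, cost₁ Ξ P₁ P₂ ≤ cost₁ Ξ Q₁ P₂) ∧ (∀ Q₂, cost₂ Ξ P₁ P₂ ≤ cost₂ Ξ P₁ Q₂)

/-- A separable cost sharing protocol: nonnegative, budget-balanced, stable and
separable (cost shares on an edge depend only on the set of players using it). -/
structure IsSeparable {G : SimpleGraph V} {s₁ t₁ s₂ t₂ : V} (c : Sym2 V → ℝ)
    (Ξ : Protocol G s₁ t₁ s₂ t₂) : Prop where
  nonneg : ∀ P₁ P₂ i e, 0 ≤ Ξ P₁ P₂ i e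
  budget : ∀ P₁ P₂ e, (usedBy P₁ P₂ e).Nonempty →
    ∑ i ∈ usedBy P₁ P₂ e, Ξ P₁ P₂ i e = c e
  stable : ∃ P₁ P₂, IsPNE Ξ P₁ P₂
  separable : ∀ P₁ P₂ Q₁ Q₂ e, usedBy P₁ P₂ e = usedBy Q₁ Q₂ e →
    ∀ i, Ξ P₁ P₂ i e = Ξ Q₁ Q₂ i e

/-- A Steiner forest `F` is enforceable if the profile of the unique paths of
the two players inside `F` is a pure Nash equilibrium of the game induced by
some separable cost sharing protocol. -/
def Enforceable (G : SimpleGraph V) (s₁ t₁ s₂ t₂ : V) (c : Sym2 V → ℝ)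
    (F : Finset (Sym2 V)) : Prop :=
  ∃ (P₁ : Strat G s₁ t₁) (P₂ : Strat G s₂ t₂),
    (∀ e ∈ P₁.1.edges, e ∈ F) ∧ (∀ e ∈ P₂.1.edges, e ∈ F) ∧
    (∀ Q₁ : Strat G s₁ t₁, (∀ e ∈ Q₁.1.edges, e ∈ F) → Q₁ = P₁) ∧
    (∀ Q₂ : Strat G s₂ t₂, (∀ e ∈ Q₂.1.edges, e ∈ F) → Q₂ = P₂) ∧
    ∃ Ξ : Protocol G s₁ t₁ s₂ t₂, IsSeparable c Ξ ∧ IsPNE Ξ P₁ P₂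

/-- `(G,(s₁,t₁),(s₂,t₂))` is efficient: for every nonnegative cost function
some optimal Steiner forest is enforceable (the PoS is 1). -/
def Efficient (G : SimpleGraph V) (s₁ t₁ s₂ t₂ : V) : Prop :=
  ∀ c : Sym2 V → ℝ, (∀ e, 0 ≤ c e) →
    ∃ F, IsOptimalSteinerForest G s₁ t₁ s₂ t₂ c F ∧ Enforceable G s₁ t₁ s₂ t₂ c F

/-- `(G,(s₁,t₁),(s₂,t₂))` is strongly efficient: for every nonnegative cost
function every optimal Steiner forest is enforceable. -/
def StronglyEfficient (G : SimpleGraph V) (s₁ t₁ s₂ t₂ : V) : Prop :=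
  ∀ c : Sym2 V → ℝ, (∀ e, 0 ≤ c e) →
    ∀ F, IsOptimalSteinerForest G s₁ t₁ s₂ t₂ c F → Enforceable G s₁ t₁ s₂ t₂ c F


/-- The `n`-fan: a path with `n + 1` vertices `some 0, …, some n` together with
the hub `none`, which is adjacent to all path vertices. -/
def fanGraph (n : ℕ) : SimpleGraph (Option (Fin (n + 1))) :=
  SimpleGraph.fromRel fun p q =>
    p = none ∨ q = none ∨
    ∃ i j : Fin (n + 1), p = some i ∧ q = some j ∧ i.val + 1 = j.val


set_option linter.unusedSectionVars false


/-- Total `f`-weight of a walk. -/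
def wsum {G : SimpleGraph V} (f : Sym2 V → ℝ) {u w : V} (p : G.Walk u w) : ℝ :=
  (p.edges.map f).sum

section basics
variable {G : SimpleGraph V} {f : Sym2 V → ℝ}

@[simp] lemma wsum_nil {u : V} : wsum f (SimpleGraph.Walk.nil : G.Walk u u) = 0 := by simp [wsum]

@[simp] lemma wsum_cons {u v w : V} (h : G.Adj u v) (p : G.Walk v w) :
    wsum f (SimpleGraph.Walk.cons h p) = f s(u, v) + wsum f p := by simp [wsum]

@[simp] lemma wsum_append {u v w : V} (p : G.Walk u v) (q : G.Walk v w) :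
    wsum f (p.append q) = wsum f p + wsum f q := by simp [wsum]

@[simp] lemma wsum_reverse {u v : V} (p : G.Walk u v) :
    wsum f p.reverse = wsum f p := by
  simp [wsum, List.sum_reverse]

@[simp] lemma wsum_copy {u v u' v' : V} (p : G.Walk u v) (h : u = u') (h' : v = v') :
    wsum f (p.copy h h') = wsum f p := by
  subst h h'; rfl

lemma list_sum_nonneg (hf : ∀ e, 0 ≤ f e) (l : List (Sym2 V)) : 0 ≤ (l.map f).sum := by
  apply List.sum_nonneg
  intro x hx
  obtain ⟨e, _, rfl⟩ := List.mem_map.1 hx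
  exact hf e

lemma wsum_nonneg (hf : ∀ e, 0 ≤ f e) {u v : V} (p : G.Walk u v) : 0 ≤ wsum f p :=
  list_sum_nonneg hf _

lemma toFinset_sum_le (hf : ∀ e, 0 ≤ f e) (l : List (Sym2 V)) :
    ∑ e ∈ l.toFinset, f e ≤ (l.map f).sum := by
  induction l with
  | nil => simp
  | cons a l ih =>
    rw [List.toFinset_cons, List.map_cons, List.sum_cons]
    by_cases h : a ∈ l.toFinset
    · rw [Finset.insert_eq_of_mem h]; linarith [hf a]
    · rw [Finset.sum_insert h]; linarith

lemma path_sum_eq {u v : V} (p : G.Walk u v) (hp : p.IsPath) :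
    ∑ e ∈ p.edges.toFinset, f e = wsum f p := by
  rw [wsum, List.sum_toFinset _ hp.isTrail.edges_nodup]

/-- Reachability using only edges in a list. -/
def R (G : SimpleGraph V) (L : List (Sym2 V)) (u w : V) : Prop :=
  ∃ p : G.Walk u w, ∀ e ∈ p.edges, e ∈ L

lemma R.refl (L : List (Sym2 V)) (u : V) : R G L u u := ⟨.nil, by simp⟩

lemma R.symm {L : List (Sym2 V)} {u w : V} (h : R G L u w) : R G L w u := by
  obtain ⟨p, hp⟩ := h
  exact ⟨p.reverse, by simpa using hp⟩

lemma R.trans {L : List (Sym2 V)} {u v w : V} (h : R G L u v) (h' : R G L v w) : R G L u w := by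
  obtain ⟨p, hp⟩ := h
  obtain ⟨q, hq⟩ := h'
  refine ⟨p.append q, ?_⟩
  intro e he
  rw [SimpleGraph.Walk.edges_append, List.mem_append] at he
  exact he.elim (hp e) (hq e)

lemma R.of_walk {L : List (Sym2 V)} {u w : V} (p : G.Walk u w) (h : p.edges ⊆ L) : R G L u w :=
  ⟨p, fun _ he => h he⟩

/-- Distance: infimum of walk costs. -/
noncomputable def dist (G : SimpleGraph V) (f : Sym2 V → ℝ) (u w : V) : ℝ :=
  ⨅ p : G.Walk u w, wsum f p

lemma dist_bdd (hf : ∀ e, 0 ≤ f e) (u w : V) :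
    BddBelow (Set.range fun p : G.Walk u w => wsum f p) :=
  ⟨0, by rintro _ ⟨p, rfl⟩; exact wsum_nonneg hf p⟩

lemma dist_le (hf : ∀ e, 0 ≤ f e) {u w : V} (p : G.Walk u w) : dist G f u w ≤ wsum f p :=
  ciInf_le (dist_bdd hf u w) p

lemma le_dist {u w : V} (q : G.Walk u w) {x : ℝ} (h : ∀ p : G.Walk u w, x ≤ wsum f p) :
    x ≤ dist G f u w :=
  haveI : Nonempty (G.Walk u w) := ⟨q⟩
  le_ciInf h

lemma dist_nonneg (hf : ∀ e, 0 ≤ f e) (u w : V) : 0 ≤ dist G f u w :=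
  Real.iInf_nonneg fun p => wsum_nonneg hf p

lemma dist_self (hf : ∀ e, 0 ≤ f e) (u : V) : dist G f u u = 0 :=
  le_antisymm (by simpa using dist_le hf (SimpleGraph.Walk.nil : G.Walk u u)) (dist_nonneg hf u u)

lemma dist_adj (hf : ∀ e, 0 ≤ f e) {u v w : V} (h : G.Adj v w) :
    dist G f u w ≤ dist G f u v + f s(v, w) := by
  by_cases hn : Nonempty (G.Walk u v)
  · obtain ⟨q⟩ := hn
    have : dist G f u w - f s(v, w) ≤ dist G f u v := by
      apply le_dist q
      intro p
      have := dist_le hf (p.append (SimpleGraph.Walk.cons h .nil))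
      simp at this
      linarith
    linarith
  · have : IsEmpty (G.Walk u w) := by
      refine ⟨fun p => hn ⟨p.append (SimpleGraph.Walk.cons h.symm .nil)⟩⟩
    have h0 : dist G f u w = 0 := by
      unfold dist; exact Real.iInf_of_isEmpty _
    rw [h0]
    have := dist_nonneg (G := G) hf u v
    linarith [hf s(v, w)]

lemma dist_walk (hf : ∀ e, 0 ≤ f e) {u v w : V} (p : G.Walk v w) :
    dist G f u w ≤ dist G f u v + wsum f p := by
  induction p with
  | nil => simp
  | cons h p ih =>
    have := dist_adj (u := u) hf h
    rw [wsum_cons]; linarith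

/-- Lipschitz-lower bound along walks. -/
lemma pot_walk {Φ : V → ℝ} {g : Sym2 V → ℝ}
    {u w : V} (p : G.Walk u w) (h : ∀ a b, s(a, b) ∈ p.edges → |Φ a - Φ b| ≤ g s(a, b)) :
    Φ w - Φ u ≤ wsum g p := by
  induction p with
  | nil => simp
  | cons hh p ih =>
    rw [wsum_cons]
    have h1 := ih (fun a b hab => h a b (by simp [hab]))
    have h2 := h _ _ (List.mem_cons_self : s(_, _) ∈ (SimpleGraph.Walk.cons hh p).edges)
    rw [abs_le] at h2
    linarith [h2.1]

end basics

section opt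
variable {G : SimpleGraph V} {s₁ t₁ s₂ t₂ : V} {c : Sym2 V → ℝ} {F : Finset (Sym2 V)}

lemma uniq_in {u w : V} (hF : (SimpleGraph.fromEdgeSet (↑F : Set (Sym2 V))).IsAcyclic)
    (p q : G.Walk u w) (hp : p.IsPath) (hq : q.IsPath)
    (hpF : ∀ e ∈ p.edges, e ∈ F) (hqF : ∀ e ∈ q.edges, e ∈ F) : p = q := by
  have h1 : ∀ e ∈ p.edges, e ∈ (SimpleGraph.fromEdgeSet (↑F : Set (Sym2 V))).edgeSet := by
    intro e he
    simp [hpF e he]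
    exact SimpleGraph.not_isDiag_of_mem_edgeSet _ (p.edges_subset_edgeSet he)
  have h2 : ∀ e ∈ q.edges, e ∈ (SimpleGraph.fromEdgeSet (↑F : Set (Sym2 V))).edgeSet := by
    intro e he
    simp [hqF e he]
    exact SimpleGraph.not_isDiag_of_mem_edgeSet _ (q.edges_subset_edgeSet he)
  haveI := hF.subsingleton_path u w
  have := Subsingleton.elim (α := (SimpleGraph.fromEdgeSet (↑F : Set (Sym2 V))).Path u w)
    ⟨p.transfer _ h1, hp.transfer h1⟩ ⟨q.transfer _ h2, hq.transfer h2⟩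
  have h3 : p.transfer _ h1 = q.transfer _ h2 := congrArg Subtype.val this
  apply SimpleGraph.Walk.ext_support
  have := congrArg SimpleGraph.Walk.support h3
  simpa using this

lemma opt_le (hc : ∀ e, 0 ≤ c e) (hF : IsOptimalSteinerForest G s₁ t₁ s₂ t₂ c F)
    (L : List (Sym2 V)) (h1 : R G L s₁ t₁) (h2 : R G L s₂ t₂) : cost c F ≤ (L.map c).sum := by
  classical
  set H : SimpleGraph V := SimpleGraph.fromEdgeSet ({e | e ∈ L} ∩ G.edgeSet) with hH
  have hHG : H ≤ G := by
    intro a b hab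
    rw [hH, SimpleGraph.fromEdgeSet_adj] at hab
    exact hab.1.2
  obtain ⟨T, hTH, hT, hTr⟩ := SimpleGraph.exists_isAcyclic_reachable_eq_le (G := H)
  have key : ∀ s t, R G L s t → ∃ p : G.Walk s t, p.IsPath ∧ ∀ e ∈ p.edges, e ∈ T.edgeSet := by
    rintro s t ⟨p, hp⟩
    have h1 : ∀ e ∈ p.edges, e ∈ H.edgeSet := by
      intro e he
      have := p.edges_subset_edgeSet he
      simp [hH, hp e he, this]
      exact SimpleGraph.not_isDiag_of_mem_edgeSet _ this
    have h2 : H.Reachable s t := ⟨p.transfer _ h1⟩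
    have h3 : T.Reachable s t := by rw [hTr]; exact h2
    obtain ⟨q, hq⟩ := h3.exists_isPath
    have h4 : ∀ e ∈ q.edges, e ∈ G.edgeSet := fun e he =>
      SimpleGraph.edgeSet_mono (hTH.trans hHG) (q.edges_subset_edgeSet he)
    refine ⟨q.transfer _ h4, hq.transfer h4, ?_⟩
    intro e he
    rw [SimpleGraph.Walk.edges_transfer] at he
    exact q.edges_subset_edgeSet he
  set F' : Finset (Sym2 V) := L.toFinset.filter (· ∈ T.edgeSet) with hF'
  have hTL : ∀ e, e ∈ T.edgeSet → e ∈ L := by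
    intro e he
    have := SimpleGraph.edgeSet_mono hTH he
    simp [hH] at this
    exact this.1.1
  have hF'T : (↑F' : Set (Sym2 V)) = T.edgeSet := by
    ext e
    simp [hF']
    exact hTL e
  have hst : IsSteinerForest G s₁ t₁ s₂ t₂ F' := by
    refine ⟨?_, ?_, ?_, ?_⟩
    · rw [hF'T]; exact SimpleGraph.edgeSet_mono (hTH.trans hHG)
    · rw [hF'T, SimpleGraph.fromEdgeSet_edgeSet]; exact hT
    · obtain ⟨p, hp, h⟩ := key _ _ h1
      exact ⟨p, hp, fun e he => by rw [← Finset.mem_coe, hF'T]; exact h e he⟩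
    · obtain ⟨p, hp, h⟩ := key _ _ h2
      exact ⟨p, hp, fun e he => by rw [← Finset.mem_coe, hF'T]; exact h e he⟩
  calc cost c F ≤ cost c F' := hF.2 F' hst
    _ ≤ ∑ e ∈ L.toFinset, c e :=
        Finset.sum_le_sum_of_subset_of_nonneg (Finset.filter_subset _ _) (fun e _ _ => hc e)
    _ ≤ _ := toFinset_sum_le hc L

end opt


section enf
variable {G : SimpleGraph V} {s₁ t₁ s₂ t₂ : V} {c : Sym2 V → ℝ} {F : Finset (Sym2 V)}

/-- Absolute difference of a potential along an edge. -/
def absd (Φ : V → ℝ) : Sym2 V → ℝ :=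
  Sym2.lift ⟨fun a b => |Φ a - Φ b|, fun a b => abs_sub_comm _ _⟩

@[simp] lemma absd_mk (Φ : V → ℝ) (a b : V) : absd Φ s(a, b) = |Φ a - Φ b| := rfl

lemma absd_nonneg (Φ : V → ℝ) (e : Sym2 V) : 0 ≤ absd Φ e := by
  induction e using Sym2.ind with
  | _ a b => exact abs_nonneg _

/-- The shares of the players on an edge. -/
noncomputable def share (c : Sym2 V → ℝ) (Φ₁ Φ₂ : V → ℝ) (E₁ E₂ : List (Sym2 V))
    (S : Finset (Fin 2)) (i : Fin 2) (e : Sym2 V) : ℝ :=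
  if S = Finset.univ then
    (if e ∈ E₁ ∧ e ∈ E₂ then (if i = 0 then absd Φ₁ e else absd Φ₂ e)
     else if e ∈ E₁ then (if i = 0 then 0 else c e)
     else (if i = 0 then c e else 0))
  else c e

lemma usedBy_eq_univ {P₁ : Strat G s₁ t₁} {P₂ : Strat G s₂ t₂} {e : Sym2 V}
    (h1 : e ∈ P₁.1.edges) (h2 : e ∈ P₂.1.edges) : usedBy P₁ P₂ e = Finset.univ := by
  simp only [usedBy, h1, h2, if_true]; rfl

lemma usedBy_left {P₁ : Strat G s₁ t₁} {P₂ : Strat G s₂ t₂} {e : Sym2 V}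
    (h1 : e ∈ P₁.1.edges) (h2 : e ∉ P₂.1.edges) : usedBy P₁ P₂ e = {0} := by
  simp [usedBy, h1, h2]

lemma usedBy_right {P₁ : Strat G s₁ t₁} {P₂ : Strat G s₂ t₂} {e : Sym2 V}
    (h1 : e ∉ P₁.1.edges) (h2 : e ∈ P₂.1.edges) : usedBy P₁ P₂ e = {1} := by
  simp [usedBy, h1, h2]

lemma enf (hc : ∀ e, 0 ≤ c e) (hF : (SimpleGraph.fromEdgeSet (↑F : Set (Sym2 V))).IsAcyclic)
    (P₁ : G.Walk s₁ t₁) (P₂ : G.Walk s₂ t₂) (hP₁ : P₁.IsPath) (hP₂ : P₂.IsPath)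
    (hF₁ : ∀ e ∈ P₁.edges, e ∈ F) (hF₂ : ∀ e ∈ P₂.edges, e ∈ F)
    (Φ₁ Φ₂ : V → ℝ)
    (hL₁ : ∀ a b, G.Adj a b → |Φ₁ a - Φ₁ b| ≤ c s(a, b))
    (hL₂ : ∀ a b, G.Adj a b → |Φ₂ a - Φ₂ b| ≤ c s(a, b))
    (hsplit : ∀ e, e ∈ P₁.edges → e ∈ P₂.edges → absd Φ₁ e + absd Φ₂ e = c e)
    (h₁ : wsum (fun e => if e ∈ P₂.edges then absd Φ₁ e else c e) P₁ ≤ Φ₁ t₁ - Φ₁ s₁)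
    (h₂ : wsum (fun e => if e ∈ P₁.edges then absd Φ₂ e else c e) P₂ ≤ Φ₂ t₂ - Φ₂ s₂) :
    Enforceable G s₁ t₁ s₂ t₂ c F := by
  have hL₁' : ∀ e ∈ G.edgeSet, absd Φ₁ e ≤ c e := by
    intro e he
    induction e using Sym2.ind with
    | _ a b => exact hL₁ a b he
  have hL₂' : ∀ e ∈ G.edgeSet, absd Φ₂ e ≤ c e := by
    intro e he
    induction e using Sym2.ind with
    | _ a b => exact hL₂ a b he
  set Ξ : Protocol G s₁ t₁ s₂ t₂ := fun Q₁ Q₂ i e =>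
    share c Φ₁ Φ₂ P₁.edges P₂.edges (usedBy Q₁ Q₂ e) i e with hΞ
  have hne0 : ({0} : Finset (Fin 2)) ≠ Finset.univ := by decide
  have hne1 : ({1} : Finset (Fin 2)) ≠ Finset.univ := by decide
  have hpne : IsPNE Ξ ⟨P₁, hP₁⟩ ⟨P₂, hP₂⟩ := by
    constructor
    · intro Q₁
      have e1 : cost₁ Ξ ⟨P₁, hP₁⟩ ⟨P₂, hP₂⟩
          = wsum (fun e => if e ∈ P₂.edges then absd Φ₁ e else c e) P₁ := by
        rw [← path_sum_eq P₁ hP₁]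
        apply Finset.sum_congr rfl
        intro e he
        have he : e ∈ P₁.edges := by simpa using he
        simp only [hΞ]
        by_cases h2 : e ∈ P₂.edges
        · rw [usedBy_eq_univ (P₁ := ⟨P₁, hP₁⟩) (P₂ := ⟨P₂, hP₂⟩) he h2]
          simp [share, he, h2]
        · rw [usedBy_left (P₁ := ⟨P₁, hP₁⟩) (P₂ := ⟨P₂, hP₂⟩) he h2]
          simp [share, hne0, h2]
      have e2 : cost₁ Ξ Q₁ ⟨P₂, hP₂⟩ = wsum (fun e => Ξ Q₁ ⟨P₂, hP₂⟩ 0 e) Q₁.1 :=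
        path_sum_eq Q₁.1 Q₁.2
      rw [e1, e2]
      refine h₁.trans (pot_walk Q₁.1 ?_)
      intro a b hab
      have hG : s(a, b) ∈ G.edgeSet := Q₁.1.edges_subset_edgeSet hab
      have := hL₁' _ hG
      rw [← absd_mk]
      simp only [hΞ]
      by_cases h2 : s(a, b) ∈ P₂.edges
      · rw [usedBy_eq_univ (P₁ := Q₁) (P₂ := ⟨P₂, hP₂⟩) hab h2]
        by_cases h3 : s(a, b) ∈ P₁.edges
        · simp [share, h2, h3]
        · simpa [share, h2, h3] using this
      · rw [usedBy_left (P₁ := Q₁) (P₂ := ⟨P₂, hP₂⟩) hab h2]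
        simpa [share, hne0] using this
    · intro Q₂
      have e1 : cost₂ Ξ ⟨P₁, hP₁⟩ ⟨P₂, hP₂⟩
          = wsum (fun e => if e ∈ P₁.edges then absd Φ₂ e else c e) P₂ := by
        rw [← path_sum_eq P₂ hP₂]
        apply Finset.sum_congr rfl
        intro e he
        have he : e ∈ P₂.edges := by simpa using he
        simp only [hΞ]
        by_cases h2 : e ∈ P₁.edges
        · rw [usedBy_eq_univ (P₁ := ⟨P₁, hP₁⟩) (P₂ := ⟨P₂, hP₂⟩) h2 he]
          simp [share, he, h2]
        · rw [usedBy_right (P₁ := ⟨P₁, hP₁⟩) (P₂ := ⟨P₂, hP₂⟩) h2 he]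
          simp [share, hne1, h2]
      have e2 : cost₂ Ξ ⟨P₁, hP₁⟩ Q₂ = wsum (fun e => Ξ ⟨P₁, hP₁⟩ Q₂ 1 e) Q₂.1 :=
        path_sum_eq Q₂.1 Q₂.2
      rw [e1, e2]
      refine h₂.trans (pot_walk Q₂.1 ?_)
      intro a b hab
      have hG : s(a, b) ∈ G.edgeSet := Q₂.1.edges_subset_edgeSet hab
      have := hL₂' _ hG
      rw [← absd_mk]
      simp only [hΞ]
      by_cases h2 : s(a, b) ∈ P₁.edges
      · rw [usedBy_eq_univ (P₁ := ⟨P₁, hP₁⟩) (P₂ := Q₂) h2 hab]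
        by_cases h3 : s(a, b) ∈ P₂.edges
        · simp [share, h2, h3]
        · simpa [share, h2, h3] using this
      · rw [usedBy_right (P₁ := ⟨P₁, hP₁⟩) (P₂ := Q₂) h2 hab]
        simpa [share, hne1] using this
  refine ⟨⟨P₁, hP₁⟩, ⟨P₂, hP₂⟩, hF₁, hF₂, ?_, ?_, Ξ, ⟨?_, ?_, ⟨_, _, hpne⟩, ?_⟩, hpne⟩
  · intro Q hQ
    exact Subtype.ext (uniq_in hF _ _ Q.2 hP₁ hQ hF₁)
  · intro Q hQ
    exact Subtype.ext (uniq_in hF _ _ Q.2 hP₂ hQ hF₂)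
  · intro Q₁ Q₂ i e
    have a1 := absd_nonneg Φ₁ e
    have a2 := absd_nonneg Φ₂ e
    have a3 := hc e
    simp only [hΞ, share]
    split_ifs <;> first | assumption | exact le_refl _
  · intro Q₁ Q₂ e hne
    simp only [hΞ]
    by_cases h1 : e ∈ Q₁.1.edges <;> by_cases h2 : e ∈ Q₂.1.edges
    · rw [usedBy_eq_univ h1 h2, Fin.sum_univ_two]
      by_cases h3 : e ∈ P₁.edges <;> by_cases h4 : e ∈ P₂.edges
      · simpa [share, h3, h4] using hsplit e h3 h4
      all_goals simp [share, h3, h4]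
    · rw [usedBy_left h1 h2]; simp [share, hne0]
    · rw [usedBy_right h1 h2]; simp [share, hne1]
    · simp [usedBy, h1, h2] at hne
  · intro Q₁ Q₂ Q₁' Q₂' e h i
    simp only [hΞ, h]

/-- Edge-disjoint case. -/
lemma enf_disjoint (hc : ∀ e, 0 ≤ c e) (hF : IsOptimalSteinerForest G s₁ t₁ s₂ t₂ c F)
    (P₁ : G.Walk s₁ t₁) (P₂ : G.Walk s₂ t₂) (hP₁ : P₁.IsPath) (hP₂ : P₂.IsPath)
    (hF₁ : ∀ e ∈ P₁.edges, e ∈ F) (hF₂ : ∀ e ∈ P₂.edges, e ∈ F)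
    (hd : ∀ e, e ∈ P₁.edges → e ∈ P₂.edges → False) :
    Enforceable G s₁ t₁ s₂ t₂ c F := by
  have hcost : wsum c P₁ + wsum c P₂ ≤ cost c F := by
    rw [← path_sum_eq P₁ hP₁, ← path_sum_eq P₂ hP₂, ← Finset.sum_union]
    · apply Finset.sum_le_sum_of_subset_of_nonneg _ (fun e _ _ => hc e)
      intro e he
      simp at he
      exact he.elim (hF₁ e) (hF₂ e)
    · rw [Finset.disjoint_left]
      intro e h1 h2
      exact hd e (by simpa using h1) (by simpa using h2)
  have key1 : ∀ Q : G.Walk s₁ t₁, wsum c P₁ ≤ wsum c Q := by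
    intro Q
    have := opt_le hc hF (Q.edges ++ P₂.edges) (R.of_walk Q (by simp)) (R.of_walk P₂ (by simp))
    rw [List.map_append, List.sum_append] at this
    change _ ≤ wsum c Q + wsum c P₂ at this
    linarith
  have key2 : ∀ Q : G.Walk s₂ t₂, wsum c P₂ ≤ wsum c Q := by
    intro Q
    have := opt_le hc hF (P₁.edges ++ Q.edges) (R.of_walk P₁ (by simp)) (R.of_walk Q (by simp))
    rw [List.map_append, List.sum_append] at this
    change _ ≤ wsum c P₁ + wsum c Q at this
    linarith
  have hlip : ∀ s a b, G.Adj a b → |dist G c s a - dist G c s b| ≤ c s(a, b) := by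
    intro s a b hab
    have h1 := dist_adj (u := s) hc hab
    have h2 := dist_adj (u := s) hc hab.symm
    rw [Sym2.eq_swap] at h2
    rw [abs_le]; constructor <;> linarith
  refine enf hc hF.1.2.1 P₁ P₂ hP₁ hP₂ hF₁ hF₂ (dist G c s₁) (dist G c s₂) (hlip s₁) (hlip s₂)
    (fun e h1 h2 => (hd e h1 h2).elim) ?_ ?_
  · rw [dist_self hc, sub_zero]
    refine le_trans (le_of_eq ?_) (le_dist P₁ key1)
    unfold wsum
    congr 1
    apply List.map_congr_left
    intro e he
    rw [if_neg (fun h => hd e he h)]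
  · rw [dist_self hc, sub_zero]
    refine le_trans (le_of_eq ?_) (le_dist P₂ key2)
    unfold wsum
    congr 1
    apply List.map_congr_left
    intro e he
    rw [if_neg (fun h => hd e h he)]

end enf

section lp

lemma lp (k : ℕ) (C a1 a2 b1 b2 : ℕ → ℝ) (r1 r2 : ℝ) (hC0 : C 0 = 0)
    (hC : ∀ i j, i ≤ j → j ≤ k → C i ≤ C j)
    (ha1 : a1 0 = 0) (ha2 : a2 0 = 0) (hb1 : b1 k = 0) (hb2 : b2 k = 0)
    (h2a : ∀ i j, i ≤ k → j ≤ k → C (min i j) ≤ a1 i + a2 j)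
    (h2b : ∀ i j, i ≤ k → j ≤ k → C k - C (max i j) ≤ b1 i + b2 j)
    (hrr : C k ≤ r1 + r2)
    (hrD : ∀ x y, x ≤ k → y ≤ k → C k ≤ r1 + (a2 y + b2 x + max (C x - C y) 0))
    (hDr : ∀ x y, x ≤ k → y ≤ k → C k ≤ (a1 y + b1 x + max (C x - C y) 0) + r2)
    (hDD : ∀ x y x' y', x ≤ k → y ≤ k → x' ≤ k → y' ≤ k →
      C k ≤ (a1 y + b1 x + max (C x - C y) 0) + (a2 y' + b2 x' + max (C x' - C y') 0)) :
    ∃ φ : ℕ → ℝ, φ 0 = 0 ∧ (∀ i j, i ≤ j → j ≤ k → 0 ≤ φ j - φ i ∧ φ j - φ i ≤ C j - C i) ∧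
      (∀ y, y ≤ k → φ y ≤ a1 y ∧ C y - φ y ≤ a2 y) ∧
      (∀ x, x ≤ k → φ k - φ x ≤ b1 x ∧ (C k - φ k) - (C x - φ x) ≤ b2 x) ∧
      φ k ≤ r1 ∧ C k - φ k ≤ r2 := by
  obtain ⟨K, hKr, hKD, hKmem⟩ : ∃ K : ℝ, K ≤ r1 ∧
      (∀ x y, x ≤ k → y ≤ k → K ≤ a1 y + b1 x + max (C x - C y) 0) ∧
      (K = r1 ∨ ∃ x y, x ≤ k ∧ y ≤ k ∧ K = a1 y + b1 x + max (C x - C y) 0) := by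
    obtain ⟨m, hm, hmin⟩ := Finset.exists_min_image
      (Finset.range (k + 1) ×ˢ Finset.range (k + 1))
      (fun p => a1 p.2 + b1 p.1 + max (C p.1 - C p.2) 0) ⟨(0, 0), by simp⟩
    simp only [Finset.mem_product, Finset.mem_range, Prod.forall] at hm hmin
    refine ⟨min r1 (a1 m.2 + b1 m.1 + max (C m.1 - C m.2) 0), min_le_left _ _, ?_, ?_⟩
    · intro x y hx hy
      exact (min_le_right _ _).trans (hmin x y ⟨by omega, by omega⟩)
    · rcases min_choice r1 (a1 m.2 + b1 m.1 + max (C m.1 - C m.2) 0) with h | h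
      · left; exact h
      · right; exact ⟨m.1, m.2, by omega, by omega, h⟩
  -- consequences for K
  have hK2 : C k ≤ K + r2 := by
    rcases hKmem with rfl | ⟨x, y, hx, hy, rfl⟩
    · exact hrr
    · exact hDr x y hx hy
  have hKD2 : ∀ x y, x ≤ k → y ≤ k → C k ≤ K + (a2 y + b2 x + max (C x - C y) 0) := by
    intro x y hx hy
    rcases hKmem with rfl | ⟨x', y', hx', hy', rfl⟩
    · exact hrD x y hx hy
    · exact hDD x' y' x y hx' hy' hx hy
  set u : ℕ → ℝ := fun i => min (a1 i) (K - C k + C i + b2 i) with hu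
  have hne : (Finset.range (k + 1)).Nonempty := ⟨0, by simp⟩
  set φ : ℕ → ℝ := fun j => (Finset.range (k + 1)).inf' hne
    (fun i => u i + max (C j - C i) 0) with hφ
  have hφle : ∀ j i, i ≤ k → φ j ≤ u i + max (C j - C i) 0 := by
    intro j i hi
    exact Finset.inf'_le (fun i => u i + max (C j - C i) 0) (by simp; omega)
  have hφmem : ∀ j, ∃ i, i ≤ k ∧ φ j = u i + max (C j - C i) 0 := by
    intro j
    obtain ⟨i, hi, h⟩ := Finset.exists_mem_eq_inf' hne (fun i => u i + max (C j - C i) 0)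
    exact ⟨i, by simp at hi; omega, h⟩
  have hCnn : ∀ i, i ≤ k → 0 ≤ C i := fun i hi => by rw [← hC0]; exact hC 0 i (by omega) hi
  have ha1nn : ∀ i, i ≤ k → 0 ≤ a1 i := by
    intro i hi
    have := h2a i 0 hi (by omega)
    simp [hC0, ha2] at this; exact this
  have hb2nn : ∀ i, i ≤ k → 0 ≤ b2 i := by
    intro i hi
    have := h2b k i (by omega) hi
    rw [max_eq_left hi, hb1] at this; linarith
  have hKC : ∀ i, i ≤ k → C k ≤ K + C i + b2 i := by
    intro i hi
    have := hKD2 i 0 hi (by omega)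
    rw [hC0, ha2, sub_zero, max_eq_left (hCnn i hi)] at this
    linarith
  have hunn : ∀ i, i ≤ k → 0 ≤ u i := by
    intro i hi
    have := ha1nn i hi
    have := hKC i hi
    simp only [hu]
    apply le_min <;> linarith
  have hφ0 : φ 0 = 0 := by
    apply le_antisymm
    · have := hφle 0 0 (by omega)
      have h2 : u 0 ≤ a1 0 := min_le_left _ _
      simp at this; linarith
    · obtain ⟨i, hi, h⟩ := hφmem 0
      rw [h]
      have := hunn i hi
      have := le_max_right (C 0 - C i) 0
      linarith
  have hmono : ∀ i j, i ≤ j → j ≤ k → 0 ≤ φ j - φ i ∧ φ j - φ i ≤ C j - C i := by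
    intro i j hij hj
    have hcc := hC i j hij hj
    constructor
    · obtain ⟨l, hl, h⟩ := hφmem j
      have := hφle i l hl
      rw [h]
      have : max (C i - C l) 0 ≤ max (C j - C l) 0 := max_le_max (by linarith) le_rfl
      linarith
    · obtain ⟨l, hl, h⟩ := hφmem i
      have := hφle j l hl
      rw [h]
      have : max (C j - C l) 0 ≤ max (C i - C l) 0 + (C j - C i) := by
        apply max_le
        · linarith [le_max_left (C i - C l) 0]
        · linarith [le_max_right (C i - C l) 0]
      linarith
  -- lower bound on φ through a2
  have hla2 : ∀ y, y ≤ k → C y - φ y ≤ a2 y := by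
    intro y hy
    obtain ⟨i, hi, h⟩ := hφmem y
    rw [h]
    simp only [hu]
    have h1 := h2a i y hi hy
    have h2 := hKD2 i y hi hy
    have hm1 := le_max_left (C y - C i) 0
    have hm2 := le_max_right (C y - C i) 0
    rcases min_choice (a1 i) (K - C k + C i + b2 i) with hh | hh <;> rw [hh]
    · rcases le_total i y with hiy | hiy
      · rw [min_eq_left hiy] at h1; linarith
      · rw [min_eq_right hiy] at h1; linarith
    · rcases le_total (C i) (C y) with hh' | hh'
      · rw [max_eq_right (by linarith)] at h2
        linarith
      · rw [max_eq_left (by linarith)] at h2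
        linarith
  have hφk : φ k = K := by
    apply le_antisymm
    · have := hφle k k le_rfl
      have h2 : u k ≤ K - C k + C k + b2 k := min_le_right _ _
      rw [hb2] at h2
      simp at this; linarith
    · obtain ⟨i, hi, h⟩ := hφmem k
      rw [h]
      simp only [hu]
      rw [max_eq_left (by linarith [hC i k hi le_rfl])]
      rcases min_choice (a1 i) (K - C k + C i + b2 i) with hh | hh <;> rw [hh]
      · have := hKD k i le_rfl hi
        rw [hb1, max_eq_left (by linarith [hC i k hi le_rfl])] at this
        linarith
      · linarith [hb2nn i hi]
  refine ⟨φ, hφ0, hmono, ?_, ?_, ?_, ?_⟩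
  · intro y hy
    refine ⟨?_, hla2 y hy⟩
    have := hφle y y hy
    have h2 : u y ≤ a1 y := min_le_left _ _
    simp at this; linarith
  · intro x hx
    constructor
    · rw [hφk]
      obtain ⟨i, hi, h⟩ := hφmem x
      rw [h]
      simp only [hu]
      have hm1 := le_max_left (C x - C i) 0
      have hm2 := le_max_right (C x - C i) 0
      rcases min_choice (a1 i) (K - C k + C i + b2 i) with hh | hh <;> rw [hh]
      · linarith [hKD x i hx hi]
      · have := h2b x i hx hi
        rcases le_total x i with hxi | hxi
        · rw [max_eq_right hxi] at this; linarith
        · rw [max_eq_left hxi] at this; linarith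
    · rw [hφk]
      have := hφle x x hx
      have h2 : u x ≤ K - C k + C x + b2 x := min_le_right _ _
      simp at this; linarith
  · rw [hφk]; exact hKr
  · rw [hφk]; linarith

end lp


section seg
variable {G : SimpleGraph V} {c : Sym2 V → ℝ} {v : ℕ → V} {k : ℕ}

/-- Prefix costs along a vertex sequence. -/
def Cs (c : Sym2 V → ℝ) (v : ℕ → V) (j : ℕ) : ℝ := ∑ l ∈ Finset.range j, c s(v l, v (l + 1))

/-- Edges of a segment. -/
def segL (v : ℕ → V) (i j : ℕ) : List (Sym2 V) := (List.Ico i j).map fun l => s(v l, v (l + 1))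

@[simp] lemma Cs_zero : Cs c v 0 = 0 := by simp [Cs]

lemma Cs_succ (j : ℕ) : Cs c v (j + 1) = Cs c v j + c s(v j, v (j + 1)) := by
  simp [Cs, Finset.sum_range_succ]

lemma Cs_mono (hc : ∀ e, 0 ≤ c e) {i j : ℕ} (h : i ≤ j) : Cs c v i ≤ Cs c v j := by
  induction j, h using Nat.le_induction with
  | base => exact le_rfl
  | succ j _ ih => rw [Cs_succ]; linarith [hc s(v j, v (j + 1))]

lemma Cs_nonneg (hc : ∀ e, 0 ≤ c e) (j : ℕ) : 0 ≤ Cs c v j := by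
  have := Cs_mono (v := v) hc (Nat.zero_le j)
  simpa using this

lemma segL_sum {i j : ℕ} (h : i ≤ j) : ((segL v i j).map c).sum = Cs c v j - Cs c v i := by
  induction j, h using Nat.le_induction with
  | base => simp [segL]
  | succ j hj ih =>
    rw [Cs_succ, segL, List.Ico.succ_top hj, List.map_append, List.map_append, List.sum_append]
    rw [segL] at ih
    rw [ih]; simp; ring

lemma R_seg {L : List (Sym2 V)} (hadj : ∀ j, j < k → G.Adj (v j) (v (j + 1))) {i x y j : ℕ}
    (hix : i ≤ x) (hxy : x ≤ y) (hyj : y ≤ j) (hj : j ≤ k)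
    (hL : segL v i j ⊆ L) : R G L (v x) (v y) := by
  induction y, hxy using Nat.le_induction with
  | base => exact R.refl _ _
  | succ y hy ih =>
    refine (ih (by omega)).trans (R.of_walk (SimpleGraph.Walk.cons (hadj y (by omega)) .nil) ?_)
    intro e he
    simp at he
    subst he
    apply hL
    simp only [segL, List.mem_map, List.Ico.mem]
    exact ⟨y, ⟨by omega, by omega⟩, rfl⟩

lemma R_eq {L : List (Sym2 V)} {u w : V} (h : u = w) : R G L u w := by
  subst h; exact R.refl _ _

lemma seg_walk (hadj : ∀ j, j < k → G.Adj (v j) (v (j + 1))) {x y : ℕ}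
    (hxy : x ≤ y) (hy : y ≤ k) : ∃ p : G.Walk (v x) (v y), wsum c p = Cs c v y - Cs c v x := by
  induction y, hxy using Nat.le_induction with
  | base => exact ⟨.nil, by simp⟩
  | succ y hxy ih =>
    obtain ⟨p, hp⟩ := ih (by omega)
    refine ⟨p.append (SimpleGraph.Walk.cons (hadj y (by omega)) .nil), ?_⟩
    rw [wsum_append, hp, Cs_succ]; simp; ring

lemma wsum_path_eq {u w : V} (p : G.Walk u w) (hp : p.IsPath) (h : u = w) : wsum c p = 0 := by
  subst h
  cases p with
  | nil => simp
  | cons h p => simp at hp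

end seg

/-- Configuration of two paths sharing a common segment. -/
structure Cfg (G : SimpleGraph V) (c : Sym2 V → ℝ) (s1 t1 s2 t2 : V) where
  k : ℕ
  v : ℕ → V
  a : V
  b : V
  ha : v 0 = a
  hb : v k = b
  adj : ∀ j, j < k → G.Adj (v j) (v (j + 1))
  inj : ∀ i j, i ≤ k → j ≤ k → v i = v j → i = j
  A1 : G.Walk s1 a
  B1 : G.Walk b t1
  A2 : G.Walk s2 a
  B2 : G.Walk b t2
  pA1 : A1.IsPath
  pB1 : B1.IsPath
  pA2 : A2.IsPath
  pB2 : B2.IsPath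
  vA1 : ∀ j, j ≤ k → v j ∈ A1.support → j = 0
  vA2 : ∀ j, j ≤ k → v j ∈ A2.support → j = 0
  vB1 : ∀ j, j ≤ k → v j ∈ B1.support → j = k
  vB2 : ∀ j, j ≤ k → v j ∈ B2.support → j = k
  AA : ∀ x, x ∈ A1.support → x ∈ A2.support → x = a
  BB : ∀ x, x ∈ B1.support → x ∈ B2.support → x = b
  AB : k ≠ 0 → ∀ x, x ∈ A1.support → x ∈ B2.support → False
  BA : k ≠ 0 → ∀ x, x ∈ A2.support → x ∈ B1.support → False
  hc : ∀ e, 0 ≤ c e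
  opt : ∀ L, R G L s1 t1 → R G L s2 t2 →
    wsum c A1 + wsum c B1 + wsum c A2 + wsum c B2 + Cs c v k ≤ (L.map c).sum

namespace Cfg
variable {G : SimpleGraph V} {c : Sym2 V → ℝ} {s1 t1 s2 t2 : V}

/-- Swap the players. -/
def swap (D : Cfg G c s1 t1 s2 t2) : Cfg G c s2 t2 s1 t1 where
  k := D.k
  v := D.v
  a := D.a
  b := D.b
  ha := D.ha
  hb := D.hb
  adj := D.adj
  inj := D.inj
  A1 := D.A2
  B1 := D.B2
  A2 := D.A1
  B2 := D.B1
  pA1 := D.pA2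
  pB1 := D.pB2
  pA2 := D.pA1
  pB2 := D.pB1
  vA1 := D.vA2
  vA2 := D.vA1
  vB1 := D.vB2
  vB2 := D.vB1
  AA := fun x h h' => D.AA x h' h
  BB := fun x h h' => D.BB x h' h
  AB := fun h0 x h h' => D.BA h0 x h h'
  BA := fun h0 x h h' => D.AB h0 x h h'
  hc := D.hc
  opt := fun L h h' => by have := D.opt L h' h; linarith

lemma Cs_rev (v : ℕ → V) (k j : ℕ) (hj : j ≤ k) :
    Cs c (fun i => v (k - i)) j = Cs c v k - Cs c v (k - j) := by
  induction j with
  | zero => simp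
  | succ j ih =>
    rw [Cs_succ, ih (by omega)]
    have : k - j = (k - (j + 1)) + 1 := by omega
    have h2 := Cs_succ (c := c) (v := v) (k - (j + 1))
    rw [← this, Sym2.eq_swap] at h2
    linarith

/-- Reverse the direction. -/
def rev (D : Cfg G c s1 t1 s2 t2) : Cfg G c t1 s1 t2 s2 where
  k := D.k
  v := fun i => D.v (D.k - i)
  a := D.b
  b := D.a
  ha := by simp [D.hb]
  hb := by simp [D.ha]
  adj := fun j hj => by
    have := (D.adj (D.k - (j + 1)) (by omega)).symm
    have h : D.k - (j + 1) + 1 = D.k - j := by omega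
    rw [h] at this; exact this
  inj := fun i j hi hj h => by
    have := D.inj _ _ (by omega) (by omega) h
    omega
  A1 := D.B1.reverse
  B1 := D.A1.reverse
  A2 := D.B2.reverse
  B2 := D.A2.reverse
  pA1 := D.pB1.reverse
  pB1 := D.pA1.reverse
  pA2 := D.pB2.reverse
  pB2 := D.pA2.reverse
  vA1 := fun j hj h => by
    have := D.vB1 (D.k - j) (by omega) (by simpa using h)
    omega
  vA2 := fun j hj h => by
    have := D.vB2 (D.k - j) (by omega) (by simpa using h)
    omega
  vB1 := fun j hj h => by
    have := D.vA1 (D.k - j) (by omega) (by simpa using h)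
    omega
  vB2 := fun j hj h => by
    have := D.vA2 (D.k - j) (by omega) (by simpa using h)
    omega
  AA := fun x h h' => D.BB x (by simpa using h) (by simpa using h')
  BB := fun x h h' => D.AA x (by simpa using h) (by simpa using h')
  AB := fun h0 x h h' => D.BA h0 x (by simpa using h') (by simpa using h)
  BA := fun h0 x h h' => D.AB h0 x (by simpa using h') (by simpa using h)
  hc := D.hc
  opt := fun L h h' => by
    have := D.opt L h.symm h'.symm
    rw [Cs_rev _ _ _ le_rfl]
    simp only [wsum_reverse, Nat.sub_self, Cs_zero]
    linarith

/-- Prefix costs on the common segment. -/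
def C (D : Cfg G c s1 t1 s2 t2) (j : ℕ) : ℝ := Cs c D.v j

/-- Total cost. -/
def T (D : Cfg G c s1 t1 s2 t2) : ℝ :=
  wsum c D.A1 + wsum c D.B1 + wsum c D.A2 + wsum c D.B2 + D.C D.k

variable (D : Cfg G c s1 t1 s2 t2)

lemma swap_C (j : ℕ) : D.swap.C j = D.C j := rfl
lemma swap_T : D.swap.T = D.T := by simp only [T, C, swap]; ring
lemma rev_C (j : ℕ) (hj : j ≤ D.k) : D.rev.C j = D.C D.k - D.C (D.k - j) := Cs_rev _ _ _ hj
lemma rev_T : D.rev.T = D.T := by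
  have h := D.rev_C D.k le_rfl
  have h2 : D.rev.C D.rev.k = D.C D.k := by
    change D.rev.C D.k = _
    rw [h]; simp [C]
  unfold T
  rw [h2]
  simp only [rev, wsum_reverse]; ring

lemma C_mono {i j : ℕ} (h : i ≤ j) : D.C i ≤ D.C j := Cs_mono D.hc h
lemma C_nonneg (j : ℕ) : 0 ≤ D.C j := Cs_nonneg D.hc j
lemma C_zero : D.C 0 = 0 := Cs_zero

lemma RA1 {L : List (Sym2 V)} (h : D.A1.edges ⊆ L) : R G L s1 (D.v 0) := by
  rw [D.ha]; exact R.of_walk _ h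
lemma RA2 {L : List (Sym2 V)} (h : D.A2.edges ⊆ L) : R G L s2 (D.v 0) := by
  rw [D.ha]; exact R.of_walk _ h
lemma RB1 {L : List (Sym2 V)} (h : D.B1.edges ⊆ L) : R G L (D.v D.k) t1 := by
  rw [D.hb]; exact R.of_walk _ h
lemma RB2 {L : List (Sym2 V)} (h : D.B2.edges ⊆ L) : R G L (D.v D.k) t2 := by
  rw [D.hb]; exact R.of_walk _ h

lemma f1' {x y : ℕ} (hxy : x ≤ y) (hy : y ≤ D.k) (W : G.Walk (D.v x) (D.v y)) :
    D.C y - D.C x ≤ wsum c W := by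
  have key : ∀ L, segL D.v 0 x ⊆ L → W.edges ⊆ L → segL D.v y D.k ⊆ L →
      R G L (D.v 0) (D.v D.k) := by
    intro L h1 h2 h3
    exact ((R_seg D.adj le_rfl (Nat.zero_le _) le_rfl (by omega) h1).trans
      (R.of_walk W h2)).trans (R_seg D.adj le_rfl hy le_rfl le_rfl h3)
  have h := D.opt (D.A1.edges ++ (D.A2.edges ++ (D.B1.edges ++ (D.B2.edges ++
    (segL D.v 0 x ++ (W.edges ++ segL D.v y D.k))))))
    (R.trans (R.trans (D.RA1 (by intro e he; simp [he])) (key _ (by intro e he; simp [he]) (by intro e he; simp [he]) (by intro e he; simp [he])))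
      (D.RB1 (by intro e he; simp [he])))
    (R.trans (R.trans (D.RA2 (by intro e he; simp [he])) (key _ (by intro e he; simp [he]) (by intro e he; simp [he]) (by intro e he; simp [he])))
      (D.RB2 (by intro e he; simp [he])))
  simp only [List.map_append, List.sum_append] at h
  rw [segL_sum hy, segL_sum (Nat.zero_le x), Cs_zero] at h
  simp only [wsum, C] at h ⊢
  linarith

lemma f1 {x y : ℕ} (hx : x ≤ D.k) (hy : y ≤ D.k) (W : G.Walk (D.v x) (D.v y)) :
    |D.C y - D.C x| ≤ wsum c W := by
  rcases le_total x y with h | h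
  · rw [abs_of_nonneg (by linarith [D.C_mono h])]
    exact D.f1' h hy W
  · rw [abs_sub_comm, abs_of_nonneg (by linarith [D.C_mono h])]
    simpa using D.f1' h hx W.reverse

lemma f2A {y : ℕ} (hy : y ≤ D.k) (W : G.Walk s1 (D.v y)) : wsum c D.A1 ≤ wsum c W := by
  have h := D.opt (W.edges ++ (D.A2.edges ++ (D.B1.edges ++ (D.B2.edges ++ segL D.v 0 D.k))))
    (R.trans (R.trans (R.of_walk W (by intro e he; simp [he]))
      (R_seg D.adj (Nat.zero_le _) hy le_rfl le_rfl (by intro e he; simp [he])))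
      (D.RB1 (by intro e he; simp [he])))
    (R.trans (R.trans (D.RA2 (by intro e he; simp [he]))
      (R_seg D.adj le_rfl (Nat.zero_le _) le_rfl le_rfl (by intro e he; simp [he])))
      (D.RB2 (by intro e he; simp [he])))
  simp only [List.map_append, List.sum_append] at h
  rw [segL_sum (Nat.zero_le _), Cs_zero] at h
  simp only [wsum] at h ⊢
  linarith

lemma f2B {x : ℕ} (hx : x ≤ D.k) (W : G.Walk (D.v x) t1) : wsum c D.B1 ≤ wsum c W := by
  have h : D.v x = D.rev.v (D.k - x) := by
    simp only [rev]; congr 1; omega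
  have := D.rev.f2A (y := D.k - x) (by simp [rev]) (W.reverse.copy rfl h)
  simp only [wsum_copy, wsum_reverse] at this
  simpa [rev] using this

lemma f3A' {y z : ℕ} (hyz : y ≤ z) (hz : z ≤ D.k) (W1 : G.Walk s1 (D.v y))
    (W2 : G.Walk s2 (D.v z)) :
    wsum c D.A1 + wsum c D.A2 + D.C y ≤ wsum c W1 + wsum c W2 := by
  have h := D.opt (W1.edges ++ (W2.edges ++ (D.B1.edges ++ (D.B2.edges ++ segL D.v y D.k))))
    (R.trans (R.trans (R.of_walk W1 (by intro e he; simp [he]))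
      (R_seg D.adj le_rfl (hyz.trans hz) le_rfl le_rfl (by intro e he; simp [he])))
      (D.RB1 (by intro e he; simp [he])))
    (R.trans (R.trans (R.of_walk W2 (by intro e he; simp [he]))
      (R_seg D.adj hyz hz le_rfl le_rfl (by intro e he; simp [he])))
      (D.RB2 (by intro e he; simp [he])))
  simp only [List.map_append, List.sum_append] at h
  rw [segL_sum (by omega)] at h
  simp only [wsum, C] at h ⊢
  linarith

lemma f3A {y z : ℕ} (hy : y ≤ D.k) (hz : z ≤ D.k) (W1 : G.Walk s1 (D.v y))
    (W2 : G.Walk s2 (D.v z)) :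
    wsum c D.A1 + wsum c D.A2 + D.C (min y z) ≤ wsum c W1 + wsum c W2 := by
  rcases le_total y z with h | h
  · rw [min_eq_left h]; exact D.f3A' h hz W1 W2
  · rw [min_eq_right h]
    have := D.swap.f3A' h hy W2 W1
    simp only [swap_C] at this
    simp only [swap] at this
    linarith

lemma f3B {x x' : ℕ} (hx : x ≤ D.k) (hx' : x' ≤ D.k) (W1 : G.Walk (D.v x) t1)
    (W2 : G.Walk (D.v x') t2) :
    wsum c D.B1 + wsum c D.B2 + (D.C D.k - D.C (max x x')) ≤ wsum c W1 + wsum c W2 := by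
  have h : D.v x = D.rev.v (D.k - x) := by
    simp only [rev]; congr 1; omega
  have h' : D.v x' = D.rev.v (D.k - x') := by
    simp only [rev]; congr 1; omega
  have := D.rev.f3A (y := D.k - x) (z := D.k - x') (by simp [rev]) (by simp [rev])
    (W1.reverse.copy rfl h) (W2.reverse.copy rfl h')
  rw [rev_C _ _ (by omega)] at this
  have e : D.k - min (D.k - x) (D.k - x') = max x x' := by omega
  rw [e] at this
  simp only [wsum_copy, wsum_reverse] at this
  simpa [rev] using this

lemma f4 (W1 : G.Walk s1 t1) (W2 : G.Walk s2 t2) : D.T ≤ wsum c W1 + wsum c W2 := by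
  have h := D.opt (W1.edges ++ W2.edges) (R.of_walk W1 (by intro e he; simp [he])) (R.of_walk W2 (by intro e he; simp [he]))
  simp only [List.map_append, List.sum_append] at h
  simpa only [T, C, wsum] using h

lemma f5a (hk : 2 ≤ D.k) (ht : t2 = D.b) (W : G.Walk s1 (D.v 2)) (W2 : G.Walk s2 t1) :
    wsum c D.A1 + wsum c D.A2 + D.C 2 ≤ wsum c W + wsum c W2 := by
  have h0 : wsum c D.B2 = 0 := wsum_path_eq _ D.pB2 ht.symm
  have h := D.opt (W.edges ++ (W2.edges ++ (D.B1.edges ++ segL D.v 2 D.k)))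
    (R.trans (R.trans (R.of_walk W (by intro e he; simp [he]))
      (R_seg D.adj le_rfl hk le_rfl le_rfl (by intro e he; simp [he])))
      (D.RB1 (by intro e he; simp [he])))
    (R.trans (R.trans (R.of_walk W2 (by intro e he; simp [he]))
      (R.symm (D.RB1 (by intro e he; simp [he])))) (R_eq (D.hb.trans ht.symm)))
  simp only [List.map_append, List.sum_append] at h
  rw [segL_sum (by omega), h0] at h
  simp only [wsum, C] at h ⊢
  linarith

lemma f5b (hk : 1 ≤ D.k) (ht : t2 = D.b) (W : G.Walk (D.v 1) t1) :
    D.C D.k - D.C 1 ≤ wsum c W := by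
  have h0 : wsum c D.B2 = 0 := wsum_path_eq _ D.pB2 ht.symm
  have h := D.opt (W.edges ++ (D.A1.edges ++ (D.A2.edges ++ (D.B1.edges ++ segL D.v 0 1))))
    (R.trans (R.trans (D.RA1 (by intro e he; simp [he]))
      (R_seg D.adj le_rfl (Nat.zero_le 1) le_rfl hk (by intro e he; simp [he])))
      (R.of_walk W (by intro e he; simp [he])))
    (R.trans (R.trans (R.trans (D.RA2 (by intro e he; simp [he]))
      (R_seg D.adj le_rfl (Nat.zero_le 1) le_rfl hk (by intro e he; simp [he])))
      (R.of_walk W (by intro e he; simp [he])))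
      (R.trans (R.symm (D.RB1 (by intro e he; simp [he]))) (R_eq (D.hb.trans ht.symm))))
  simp only [List.map_append, List.sum_append] at h
  rw [segL_sum (by omega), h0, Cs_zero] at h
  simp only [wsum, C] at h ⊢
  linarith

lemma segw {x y : ℕ} (hxy : x ≤ y) (hy : y ≤ D.k) :
    ∃ p : G.Walk (D.v x) (D.v y), wsum c p = D.C y - D.C x := seg_walk D.adj hxy hy

end Cfg


section walks
variable {G : SimpleGraph V}

lemma split_first (X : V → Prop) {u w : V} (p : G.Walk u w) (h : ∃ z ∈ p.support, X z) :
    ∃ (a : V) (p1 : G.Walk u a) (p2 : G.Walk a w), p = p1.append p2 ∧ X a ∧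
      ∀ z ∈ p1.support, X z → z = a := by
  classical
  induction p with
  | nil =>
    obtain ⟨z, hz, hX⟩ := h
    simp at hz
    subst hz
    exact ⟨z, .nil, .nil, rfl, hX, by simp⟩
  | @cons u v w e p ih =>
    by_cases hu : X u
    · exact ⟨u, .nil, .cons e p, rfl, hu, by simp⟩
    · obtain ⟨z, hz, hX⟩ := h
      have hz' : z ∈ p.support := by
        rw [SimpleGraph.Walk.support_cons, List.mem_cons] at hz
        rcases hz with rfl | hz
        · exact (hu hX).elim
        · exact hz
      obtain ⟨a, p1, p2, rfl, ha, h1⟩ := ih ⟨z, hz', hX⟩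
      refine ⟨a, .cons e p1, p2, rfl, ha, ?_⟩
      intro y hy hXy
      rw [SimpleGraph.Walk.support_cons, List.mem_cons] at hy
      rcases hy with rfl | hy
      · exact (hu hXy).elim
      · exact h1 y hy hXy

lemma path_append_inter {u v w : V} (p : G.Walk u v) (q : G.Walk v w) (h : (p.append q).IsPath)
    {z : V} (hp : z ∈ p.support) (hq : z ∈ q.support) : z = v := by
  have hn := h.support_nodup
  rw [SimpleGraph.Walk.support_append, List.nodup_append] at hn
  by_contra hne
  have hq' : z ∈ q.support.tail := by
    rw [← SimpleGraph.Walk.cons_tail_support, List.mem_cons] at hq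
    exact hq.resolve_left hne
  exact hn.2.2 z hp z hq' rfl

lemma exists_pred {u w : V} (p : G.Walk u w) (h : u ≠ w) :
    ∃ z ∈ p.support, G.Adj z w := by
  have hn : ¬ p.Nil := fun hn => h hn.eq
  exact ⟨p.penultimate, p.getVert_mem_support _, p.adj_penultimate hn⟩

lemma exists_succ {u w : V} (p : G.Walk u w) (h : u ≠ w) :
    ∃ z ∈ p.support, G.Adj u z := by
  have hn : ¬ p.Nil := fun hn => h hn.eq
  exact ⟨p.snd, p.getVert_mem_support _, p.adj_snd hn⟩

/-- Every non-hub vertex has at most two non-hub neighbours. -/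
def Deg2 (G : SimpleGraph V) (h : V) : Prop :=
  ∀ v x y z, v ≠ h → x ≠ h → y ≠ h → z ≠ h → G.Adj v x → G.Adj v y → G.Adj v z →
    x ≠ y → x ≠ z → y ≠ z → False

end walks

namespace Cfg
variable {G : SimpleGraph V} {c : Sym2 V → ℝ} {s1 t1 s2 t2 : V}
variable (D : Cfg G c s1 t1 s2 t2)

lemma wsum_take_drop {u w z : V} (p : G.Walk u w) (hz : z ∈ p.support) :
    wsum c (p.takeUntil z hz) + wsum c (p.dropUntil z hz) = wsum c p := by
  conv_rhs => rw [← p.take_spec hz]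
  rw [wsum_append]

lemma str (M : ℝ) (hM : ∀ Q : G.Walk s1 t1, M ≤ wsum c Q) : ∀ (N : ℕ) (x y : ℕ), x < y → y ≤ D.k →
    ∀ (W : G.Walk s1 (D.v y)) (W' : G.Walk (D.v x) t1), W.length + W'.length = N →
    wsum c W + wsum c W' < M →
    ∃ x y, x < y ∧ y < D.k ∧ 0 < x ∧ ∃ (W : G.Walk s1 (D.v y)) (W' : G.Walk (D.v x) t1),
      wsum c W + wsum c W' < M ∧ (∀ z, z ∈ W.support → z ∈ W'.support → False) ∧
      (∀ z, z ≤ D.k → D.v z ∈ W.support → z = y) ∧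
      (∀ z, z ≤ D.k → D.v z ∈ W'.support → z = x) := by
  intro N
  induction N using Nat.strong_induction_on with
  | _ N ih =>
  intro x y hxy hy W W' hN hlt
  by_cases h1 : ∀ z, z ∈ W.support → z ∈ W'.support → False
  swap
  · push Not at h1
    obtain ⟨z, hz, hz', -⟩ := h1
    have := hM ((W.takeUntil z hz).append (W'.dropUntil z hz'))
    rw [wsum_append] at this
    have e1 := wsum_take_drop (c := c) W hz
    have e2 := wsum_take_drop (c := c) W' hz'
    have := wsum_nonneg D.hc (W.dropUntil z hz)
    have := wsum_nonneg D.hc (W'.takeUntil z hz')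
    linarith
  by_cases h2 : ∀ z, z ≤ D.k → D.v z ∈ W.support → z = y
  swap
  · push Not at h2
    obtain ⟨z, hzk, hz, hne⟩ := h2
    have e1 := wsum_take_drop (c := c) W hz
    by_cases hzx : x < z
    · have hl := SimpleGraph.Walk.length_takeUntil_lt_length hz
        (fun h => hne (D.inj _ _ hzk hy h))
      have := wsum_nonneg D.hc (W.dropUntil _ hz)
      exact ih _ (by omega) x z hzx hzk (W.takeUntil _ hz) W' rfl (by linarith)
    · push Not at hzx
      have e2 := D.f1' (by omega) hy (W.dropUntil _ hz)
      obtain ⟨q, hq⟩ := D.segw hzx (by omega)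
      have := hM (((W.takeUntil _ hz).append q).append W')
      simp only [wsum_append] at this
      have := D.C_mono hxy.le
      linarith
  by_cases h3 : ∀ z, z ≤ D.k → D.v z ∈ W'.support → z = x
  swap
  · push Not at h3
    obtain ⟨z, hzk, hz, hne⟩ := h3
    have e1 := wsum_take_drop (c := c) W' hz
    by_cases hzx : z < y
    · have hl := SimpleGraph.Walk.length_dropUntil_lt_length hz
        (fun h => hne (D.inj _ _ hzk (by omega) h))
      have := wsum_nonneg D.hc (W'.takeUntil _ hz)
      exact ih _ (by omega) z y hzx hy W (W'.dropUntil _ hz) rfl (by linarith)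
    · push Not at hzx
      have e2 := D.f1' (by omega) hzk (W'.takeUntil _ hz)
      obtain ⟨q, hq⟩ := D.segw hzx hzk
      have := hM ((W.append q).append (W'.dropUntil _ hz))
      simp only [wsum_append] at this
      have := D.C_mono hxy.le
      linarith
  refine ⟨x, y, hxy, ?_, ?_, W, W', hlt, h1, h2, h3⟩
  · by_contra hyk
    have hyk : y = D.k := by omega
    have := hM ((W.copy rfl (by rw [hyk, D.hb])).append D.B1)
    rw [wsum_append, wsum_copy] at this
    have := D.f2B (by omega) W'
    linarith
  · by_contra hx0
    have hx0 : x = 0 := by omega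
    have := hM (D.A1.append (W'.copy (by rw [hx0, D.ha]) rfl))
    rw [wsum_append, wsum_copy] at this
    have := D.f2A (by omega) W
    linarith

lemma end_lem {h : V} (hG : Deg2 G h) {m : ℕ} (hm : 2 ≤ m) (hmk : m ≤ D.k) (hh : h = D.v m)
    (hs : s1 ≠ D.a) : s2 = D.a := by
  by_contra hs2
  obtain ⟨p1, hp1, e1⟩ := exists_pred D.A1 hs
  obtain ⟨p2, hp2, e2⟩ := exists_pred D.A2 hs2
  have e3 := D.adj 0 (by omega)
  rw [D.ha] at e3
  refine hG D.a p1 p2 (D.v 1) ?_ ?_ ?_ ?_ e1.symm e2.symm e3 ?_ ?_ ?_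
  · rw [hh, ← D.ha]; intro h; have := D.inj _ _ (by omega) hmk h; omega
  · rintro rfl; rw [hh] at hp1; have := D.vA1 m hmk hp1; omega
  · rintro rfl; rw [hh] at hp2; have := D.vA2 m hmk hp2; omega
  · rw [hh]; intro h; have := D.inj _ _ (by omega) hmk h; omega
  · rintro rfl
    have := D.AA _ hp1 hp2
    exact e1.ne this
  · rintro rfl
    have := D.vA1 1 (by omega) hp1; omega
  · rintro rfl
    have := D.vA2 1 (by omega) hp2; omega

lemma geo {h : V} (hG : Deg2 G h) (M : ℝ) (hM : ∀ Q : G.Walk s1 t1, M ≤ wsum c Q) {x y : ℕ}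
    (hxy : x < y) (hy : y ≤ D.k) (W : G.Walk s1 (D.v y)) (W' : G.Walk (D.v x) t1)
    (hlt : wsum c W + wsum c W' < M) :
    ∃ x y m, x < y ∧ y < D.k ∧ 0 < x ∧ h = D.v m ∧ y ≤ m + 1 ∧ m ≤ x + 1 ∧
      (2 ≤ m → s2 = D.a) ∧ (m + 2 ≤ D.k → t2 = D.b) ∧
      ∃ (W : G.Walk s1 (D.v y)) (W' : G.Walk (D.v x) t1), wsum c W + wsum c W' < M := by
  obtain ⟨x, y, hxy, hy, hx, W, W', hlt, hd, hW, hW'⟩ := D.str M hM _ x y hxy hy W W' rfl hlt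
  have hs1 : s1 ≠ D.v y := by
    intro h
    have h1 := D.A1.start_mem_support
    have := D.vA1 y hy.le (by rw [← h]; exact h1)
    omega
  have ht1 : D.v x ≠ t1 := by
    intro h
    have h1 := D.B1.end_mem_support
    have := D.vB1 x (by omega) (by rw [h]; exact h1)
    omega
  have hs1a : s1 ≠ D.a := by
    intro h
    have h1 := W.start_mem_support
    have := hW 0 (by omega) (by rw [D.ha, ← h]; exact h1)
    omega
  have ht1b : t1 ≠ D.b := by
    intro h
    have h1 := W'.end_mem_support
    have := hW' D.k (by omega) (by rw [D.hb, ← h]; exact h1)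
    omega
  obtain ⟨u, hu, eu⟩ := exists_pred W hs1
  obtain ⟨u', hu', eu'⟩ := exists_succ W' ht1
  have huS : ∀ j, j ≤ D.k → u ≠ D.v j := by
    rintro j hj rfl
    have := hW j hj hu
    subst this
    exact eu.ne rfl
  have huS' : ∀ j, j ≤ D.k → u' ≠ D.v j := by
    rintro j hj rfl
    have := hW' j hj hu'
    subst this
    exact eu'.ne rfl
  have huu : u ≠ u' := by
    rintro rfl
    exact hd _ hu hu'
  have nb : ∀ i z, 0 < i → i < D.k → (∀ j, j ≤ D.k → z ≠ D.v j) → G.Adj (D.v i) z →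
      h = z ∨ ∃ m, m ≤ D.k ∧ h = D.v m ∧ i ≤ m + 1 ∧ m ≤ i + 1 := by
    intro i z h0 hk hz hadj
    by_contra hcon
    push Not at hcon
    obtain ⟨hc1, hc2⟩ := hcon
    have e1 := D.adj i hk
    have e2 := D.adj (i - 1) (by omega)
    have e : i - 1 + 1 = i := by omega
    rw [e] at e2
    refine hG (D.v i) (D.v (i - 1)) (D.v (i + 1)) z ?_ ?_ ?_ (Ne.symm hc1) e2.symm e1 hadj ?_ ?_ ?_
    · intro hh; have := hc2 i (by omega) hh.symm; omega
    · intro hh; have := hc2 (i - 1) (by omega) hh.symm; omega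
    · intro hh; have := hc2 (i + 1) (by omega) hh.symm; omega
    · intro hh; have := D.inj _ _ (by omega) (by omega) hh; omega
    · exact (hz _ (by omega)).symm
    · exact (hz _ (by omega)).symm
  obtain ⟨m, hmk, hm, hym, hmx⟩ : ∃ m, m ≤ D.k ∧ h = D.v m ∧ y ≤ m + 1 ∧ m ≤ x + 1 := by
    rcases nb y u (by omega) hy huS eu.symm with h1 | ⟨m, hmk, h1, h1a, h1b⟩
    · rcases nb x u' hx (by omega) huS' eu' with h2 | ⟨m', hmk', h2, h2a, h2b⟩
      · exact (huu (h1.symm.trans h2)).elim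
      · exact (huS m' hmk' (h1.symm.trans h2)).elim
    · rcases nb x u' hx (by omega) huS' eu' with h2 | ⟨m', hmk', h2, h2a, h2b⟩
      · exact (huS' m hmk (h2.symm.trans h1)).elim
      · have := D.inj _ _ hmk hmk' (h1.symm.trans h2)
        subst this
        exact ⟨m, hmk, h1, h1a, h2b⟩
  refine ⟨x, y, m, hxy, hy, hx, hm, hym, hmx, ?_, ?_, W, W', hlt⟩
  · intro h2
    exact D.end_lem hG h2 hmk hm hs1a
  · intro h2
    refine D.rev.end_lem hG (m := D.k - m) (by omega) (by simp [rev]) ?_ ht1b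
    rw [hm]; simp only [rev]; congr 1; omega

lemma caseM1 {h : V} (hG : Deg2 G h) (hk : 3 ≤ D.k) (hh : h = D.v 1) (ht : t2 = D.b)
    (W : G.Walk s1 (D.v 2)) (W' : G.Walk (D.v 1) t1) (W2 : G.Walk s2 t2) :
    D.T ≤ wsum c W + wsum c W' + wsum c W2 := by
  have hB2 : wsum c D.B2 = 0 := wsum_path_eq _ D.pB2 ht.symm
  have hB1 := D.f2B (by omega) W'
  have htk : t2 = D.v D.k := ht.trans D.hb.symm
  obtain ⟨_, Wa, Wb, rfl, ⟨z, hz, rfl⟩, hfirst⟩ := split_first (fun q => ∃ j, j ≤ D.k ∧ q = D.v j) W2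
    ⟨t2, W2.end_mem_support, D.k, le_rfl, htk⟩
  rw [wsum_append]
  have hb := D.f1' hz le_rfl (Wb.copy rfl htk)
  rw [wsum_copy] at hb
  have hfirst' : ∀ j, j ≤ D.k → D.v j ∈ Wa.support → j = z := by
    intro j hj hm
    exact D.inj _ _ hj hz (hfirst _ hm ⟨j, hj, rfl⟩)
  unfold T
  rw [hB2]
  have hs2 : s2 ∈ D.A2.support := D.A2.start_mem_support
  by_cases hz2 : z ≤ 2
  · have := D.f3A (by omega) hz W Wa
    rw [min_eq_right hz2] at this
    linarith
  have hs2z : s2 ≠ D.v z := by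
    intro he
    have := D.vA2 z hz (by rw [← he]; exact hs2)
    omega
  by_cases hzk : z < D.k
  · exfalso
    obtain ⟨u, hu, eu⟩ := exists_pred Wa hs2z
    have huS : ∀ j, j ≤ D.k → D.v j ≠ u := by
      rintro j hj rfl
      have := hfirst' j hj hu
      subst this
      exact eu.ne rfl
    have e1 := D.adj z hzk
    have e2 := D.adj (z - 1) (by omega)
    have e : z - 1 + 1 = z := by omega
    rw [e] at e2
    refine hG (D.v z) (D.v (z - 1)) (D.v (z + 1)) u ?_ ?_ ?_ ?_ e2.symm e1 eu.symm ?_ ?_ ?_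
    · rw [hh]; intro he; have := D.inj _ _ (by omega) (by omega) he; omega
    · rw [hh]; intro he; have := D.inj _ _ (by omega) (by omega) he; omega
    · rw [hh]; intro he; have := D.inj _ _ (by omega) (by omega) he; omega
    · rw [hh]; exact (huS 1 (by omega)).symm
    · intro he; have := D.inj _ _ (by omega) (by omega) he; omega
    · exact huS _ (by omega)
    · exact huS _ (by omega)
  have hzk : z = D.k := by omega
  subst hzk
  have hbB : D.v D.k ∈ D.B1.support := by rw [D.hb]; exact D.B1.start_mem_support
  obtain ⟨u, W3, W4, hWa, huB, hfB⟩ := split_first (fun q => q ∈ D.B1.support) Wa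
    ⟨_, Wa.end_mem_support, hbB⟩
  have hhB : h ∉ D.B1.support := by
    intro hm
    rw [hh] at hm
    have := D.vB1 1 (by omega) hm
    omega
  have hut : u = t1 := by
    by_contra hut
    have hsu : s2 ≠ u := by
      rintro rfl
      exact D.BA (by omega) _ hs2 huB
    obtain ⟨p, hp, ep⟩ := exists_pred W3 hsu
    have hpB : p ∉ D.B1.support := by
      intro hm
      exact ep.ne (hfB p hp hm)
    have hpa : p ∈ Wa.support := by
      rw [hWa, SimpleGraph.Walk.mem_support_append_iff]
      exact Or.inl hp
    have hpS : ∀ j, j ≤ D.k → D.v j ≠ p := by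
      rintro j hj rfl
      have := hfirst' j hj hpa
      subst this
      exact hpB hbB
    obtain ⟨n1, hn1, en1⟩ := exists_succ (D.B1.dropUntil u huB) hut
    have hn1B : n1 ∈ D.B1.support := D.B1.support_dropUntil_subset_support huB hn1
    by_cases hub : D.b = u
    · have e2 := D.adj (D.k - 1) (by omega)
      have e : D.k - 1 + 1 = D.k := by omega
      rw [e, D.hb, hub] at e2
      refine hG u p n1 (D.v (D.k - 1)) ?_ ?_ ?_ ?_ ep.symm en1 e2.symm ?_ ?_ ?_
      · rintro rfl; exact hhB huB
      · rw [hh]; exact (hpS 1 (by omega)).symm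
      · rintro rfl; exact hhB hn1B
      · rw [hh]; intro he; have := D.inj _ _ (by omega) (by omega) he; omega
      · rintro rfl; exact hpB hn1B
      · exact (hpS _ (by omega)).symm
      · rintro rfl
        have := D.vB1 _ (by omega) hn1B
        omega
    · obtain ⟨n0, hn0, en0⟩ := exists_pred (D.B1.takeUntil u huB) hub
      have hn0B : n0 ∈ D.B1.support := D.B1.support_takeUntil_subset_support huB hn0
      refine hG u p n1 n0 ?_ ?_ ?_ ?_ ep.symm en1 en0.symm ?_ ?_ ?_
      · rintro rfl; exact hhB huB
      · rw [hh]; exact (hpS 1 (by omega)).symm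
      · rintro rfl; exact hhB hn1B
      · rintro rfl; exact hhB hn0B
      · rintro rfl; exact hpB hn1B
      · rintro rfl; exact hpB hn0B
      · rintro rfl
        have := path_append_inter _ _ (by rw [D.B1.take_spec huB]; exact D.pB1) hn0 hn1
        exact en1.ne this.symm
  have g1 := D.f5a (by omega) ht W (W3.copy rfl hut)
  have g2 := D.f5b (by omega) ht W'
  have g3 := D.f2B le_rfl (W4.reverse.copy rfl hut)
  rw [wsum_copy] at g1 g3
  rw [wsum_reverse] at g3
  have g4 := wsum_nonneg D.hc Wb
  have g5 := D.C_mono (show 1 ≤ 2 by omega)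
  rw [hWa, wsum_append]
  linarith

lemma bad1 {h : V} (hG : Deg2 G h) {x y : ℕ} (hxy : x < y) (hy : y ≤ D.k)
    (W : G.Walk s1 (D.v y)) (W' : G.Walk (D.v x) t1) (W2 : G.Walk s2 t2) :
    D.T ≤ wsum c W + wsum c W' + wsum c W2 := by
  by_contra hcon
  push Not at hcon
  obtain ⟨x, y, m, hxy, hy, hx, hm, hym, hmx, hs, ht, W, W', hlt⟩ :=
    D.geo hG (D.T - wsum c W2) (fun Q => by linarith [D.f4 Q W2]) hxy hy W W' (by linarith)
  by_cases hm2 : 2 ≤ m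
  · have hs2 := hs hm2
    by_cases hmk : m + 2 ≤ D.k
    · have ht2 := ht hmk
      have hA2 : wsum c D.A2 = 0 := wsum_path_eq _ D.pA2 hs2
      have hB2 : wsum c D.B2 = 0 := wsum_path_eq _ D.pB2 ht2.symm
      have g1 := D.f1' (Nat.zero_le _) le_rfl
        (W2.copy (hs2.trans D.ha.symm) (ht2.trans D.hb.symm))
      rw [wsum_copy, D.C_zero] at g1
      have g2 := D.f2A (by omega) W
      have g3 := D.f2B (by omega) W'
      unfold T at hlt
      linarith
    · have hy1 : y = D.k - 1 := by omega
      have hx1 : x = D.k - 2 := by omega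
      subst hy1 hx1
      have := D.rev.caseM1 hG (by simp only [rev]; omega)
        (by rw [hm]; simp only [rev]; congr 1; omega) hs2
        (W'.reverse) (W.reverse) W2.reverse
      rw [rev_T] at this
      have this' : D.T ≤ wsum c W'.reverse + wsum c W.reverse + wsum c W2.reverse := this
      simp only [wsum_reverse] at this'
      linarith
  · have hm1 : m = 1 := by omega
    have hy1 : y = 2 := by omega
    have hx1 : x = 1 := by omega
    subst hy1 hx1 hm1
    have := D.caseM1 hG (by omega) hm (ht (by omega)) W W' W2
    linarith

lemma good (hor : s2 = D.a ∨ t2 = D.b) {x y : ℕ} (hxy : x < y) (hy : y ≤ D.k)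
    (W : G.Walk s2 (D.v y)) (W' : G.Walk (D.v x) t2) :
    ∃ Q : G.Walk s2 t2, wsum c Q ≤ wsum c W + wsum c W' := by
  have := D.C_mono hxy.le
  rcases hor with h | h
  · have hs : s2 = D.v 0 := h.trans D.ha.symm
    obtain ⟨q, hq⟩ := D.segw (Nat.zero_le x) (by omega)
    refine ⟨(q.append W').copy hs.symm rfl, ?_⟩
    have := D.f1' (Nat.zero_le y) hy (W.copy hs rfl)
    rw [wsum_copy] at *
    rw [wsum_append]; linarith
  · have hs : t2 = D.v D.k := h.trans D.hb.symm
    obtain ⟨q, hq⟩ := D.segw hy le_rfl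
    refine ⟨(W.append q).copy rfl hs.symm, ?_⟩
    have := D.f1' (by omega) le_rfl (W'.copy rfl hs)
    rw [wsum_copy] at *
    rw [wsum_append]; linarith

lemma bad2 {h : V} (hG : Deg2 G h) {x y x' y' : ℕ} (hxy : x < y) (hy : y ≤ D.k)
    (hxy' : x' < y') (hy' : y' ≤ D.k)
    (W : G.Walk s1 (D.v y)) (W' : G.Walk (D.v x) t1)
    (Z : G.Walk s2 (D.v y')) (Z' : G.Walk (D.v x') t2) :
    D.T ≤ wsum c W + wsum c W' + (wsum c Z + wsum c Z') := by
  by_contra hcon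
  push Not at hcon
  obtain ⟨x0, y0, m, hxy0, hy0, hx0, hm, hym, hmx, hs, ht, -⟩ :=
    D.geo hG (D.T - (wsum c Z + wsum c Z')) (fun Q => by
      have := D.swap.bad1 hG hxy' hy' Z Z' Q
      rw [swap_T] at this
      have this' : D.T ≤ wsum c Z + wsum c Z' + wsum c Q := this
      linarith) hxy hy W W' (by linarith)
  have hor : s2 = D.a ∨ t2 = D.b := by
    by_cases hm2 : 2 ≤ m
    · exact Or.inl (hs hm2)
    · exact Or.inr (ht (by omega))
  obtain ⟨Q, hQ⟩ := D.good hor hxy' hy' Z Z'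
  have := D.bad1 hG hxy hy W W' Q
  linarith

end Cfg


lemma le_dist_add {G : SimpleGraph V} {f : Sym2 V → ℝ} {u w : V} (q : G.Walk u w) {x r : ℝ}
    (h : ∀ p : G.Walk u w, x ≤ wsum f p + r) : x ≤ dist G f u w + r := by
  have : x - r ≤ dist G f u w := le_dist q (fun p => by linarith [h p])
  linarith

namespace Cfg
variable {G : SimpleGraph V} {c : Sym2 V → ℝ} {s1 t1 s2 t2 : V}
variable (D : Cfg G c s1 t1 s2 t2)

lemma splice {x y : ℕ} (hyx : y ≤ x) (hx : x ≤ D.k)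
    (W : G.Walk s1 (D.v y)) (W' : G.Walk (D.v x) t1) :
    ∃ Q : G.Walk s1 t1, wsum c Q = wsum c W + wsum c W' + max (D.C x - D.C y) 0 := by
  obtain ⟨q, hq⟩ := D.segw hyx hx
  refine ⟨(W.append q).append W', ?_⟩
  rw [max_eq_left (by linarith [D.C_mono hyx])]
  simp only [wsum_append]; linarith

lemma Dr {h : V} (hG : Deg2 G h) {x y : ℕ} (hx : x ≤ D.k) (hy : y ≤ D.k)
    (W : G.Walk s1 (D.v y)) (W' : G.Walk (D.v x) t1) (Q : G.Walk s2 t2) :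
    D.T ≤ wsum c W + wsum c W' + max (D.C x - D.C y) 0 + wsum c Q := by
  by_cases hyx : y ≤ x
  · obtain ⟨Q', hQ'⟩ := D.splice hyx hx W W'
    rw [← hQ']
    exact D.f4 Q' Q
  · have := D.bad1 hG (by omega) hy W W' Q
    linarith [le_max_right (D.C x - D.C y) 0]

lemma DD {h : V} (hG : Deg2 G h) {x y x' y' : ℕ} (hx : x ≤ D.k) (hy : y ≤ D.k)
    (hx' : x' ≤ D.k) (hy' : y' ≤ D.k)
    (W : G.Walk s1 (D.v y)) (W' : G.Walk (D.v x) t1)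
    (Z : G.Walk s2 (D.v y')) (Z' : G.Walk (D.v x') t2) :
    D.T ≤ wsum c W + wsum c W' + max (D.C x - D.C y) 0 +
      (wsum c Z + wsum c Z' + max (D.C x' - D.C y') 0) := by
  by_cases hyx : y' ≤ x'
  · obtain ⟨Q', hQ'⟩ := D.swap.splice hyx hx' Z Z'
    have h2 : wsum c Q' = wsum c Z + wsum c Z' + max (D.C x' - D.C y') 0 := hQ'
    rw [← h2]
    exact D.Dr hG hx hy W W' Q'
  · by_cases hyx2 : y ≤ x
    · obtain ⟨Q', hQ'⟩ := D.splice hyx2 hx W W'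
      rw [← hQ']
      have := D.swap.Dr hG hx' hy' Z Z' Q'
      rw [swap_T] at this
      have this' : D.T ≤ wsum c Z + wsum c Z' + max (D.C x' - D.C y') 0 + wsum c Q' := this
      linarith
    · have := D.bad2 hG (by omega) hy (by omega) hy' W W' Z Z'
      linarith [le_max_right (D.C x - D.C y) 0, le_max_right (D.C x' - D.C y') 0]

lemma exA {y : ℕ} (hy : y ≤ D.k) : Nonempty (G.Walk s1 (D.v y)) := by
  obtain ⟨q, -⟩ := D.segw (Nat.zero_le y) hy
  exact ⟨(D.A1.copy rfl D.ha.symm).append q⟩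

lemma exB {x : ℕ} (hx : x ≤ D.k) : Nonempty (G.Walk (D.v x) t1) := by
  obtain ⟨q, -⟩ := D.segw hx le_rfl
  exact ⟨q.append (D.B1.copy D.hb.symm rfl)⟩

lemma exQ (D : Cfg G c s1 t1 s2 t2) : Nonempty (G.Walk s1 t1) := by
  obtain ⟨q⟩ := D.exA (Nat.zero_le _)
  obtain ⟨q'⟩ := D.exB (Nat.zero_le _)
  exact ⟨q.append q'⟩

lemma distA : dist G c s1 (D.v 0) = wsum c D.A1 := by
  apply le_antisymm
  · simpa using dist_le D.hc (D.A1.copy rfl D.ha.symm)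
  · exact le_dist (D.exA (Nat.zero_le _)).some (fun p => D.f2A (Nat.zero_le _) p)

lemma distB : dist G c (D.v D.k) t1 = wsum c D.B1 := by
  apply le_antisymm
  · simpa using dist_le D.hc (D.B1.copy D.hb.symm rfl)
  · exact le_dist (D.exB le_rfl).some (fun p => D.f2B le_rfl p)

lemma pot_exists (φ : ℕ → ℝ)
    (hφ : ∀ i j, i ≤ j → j ≤ D.k → 0 ≤ φ j - φ i ∧ φ j - φ i ≤ D.C j - D.C i)
    (h1 : ∀ y, y ≤ D.k → φ y ≤ dist G c s1 (D.v y) - wsum c D.A1)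
    (h2 : ∀ x, x ≤ D.k → φ D.k - φ x ≤ dist G c (D.v x) t1 - wsum c D.B1)
    (h3 : φ D.k ≤ dist G c s1 t1 - (wsum c D.A1 + wsum c D.B1)) :
    ∃ Φ : V → ℝ, (∀ a b, G.Adj a b → |Φ a - Φ b| ≤ c s(a, b)) ∧
      (∀ j, j ≤ D.k → Φ (D.v j) = wsum c D.A1 + φ j) ∧
      wsum c D.A1 + wsum c D.B1 + φ D.k ≤ Φ t1 - Φ s1 := by
  have hne : (Finset.range (D.k + 1)).Nonempty := ⟨0, by simp⟩
  set I : V → ℝ := fun w => (Finset.range (D.k + 1)).inf' hne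
    (fun j => wsum c D.A1 + φ j + dist G c (D.v j) w) with hI
  have hIle : ∀ w j, j ≤ D.k → I w ≤ wsum c D.A1 + φ j + dist G c (D.v j) w := by
    intro w j hj
    exact Finset.inf'_le (fun j => wsum c D.A1 + φ j + dist G c (D.v j) w) (by simp; omega)
  have hleI : ∀ w x, (∀ j, j ≤ D.k → x ≤ wsum c D.A1 + φ j + dist G c (D.v j) w) → x ≤ I w := by
    intro w x h
    apply Finset.le_inf'
    intro j hj
    exact h j (by simp at hj; omega)
  set Φ : V → ℝ := fun w => min (dist G c s1 w) (I w) with hΦ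
  have hstep : ∀ a b, G.Adj a b → Φ b ≤ Φ a + c s(a, b) := by
    intro a b hab
    have e1 : Φ b ≤ dist G c s1 a + c s(a, b) := (min_le_left _ _).trans (dist_adj D.hc hab)
    have e2 : Φ b - c s(a, b) ≤ I a := by
      apply hleI
      intro j hj
      have e3 : Φ b ≤ I b := min_le_right _ _
      have e4 := hIle b j hj
      have e5 := dist_adj (u := D.v j) D.hc hab
      linarith
    have e3 : Φ b - c s(a, b) ≤ Φ a := le_min (by linarith) e2
    linarith
  refine ⟨Φ, ?_, ?_, ?_⟩
  · intro a b hab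
    have e1 := hstep a b hab
    have e2 := hstep b a hab.symm
    rw [Sym2.eq_swap] at e2
    rw [abs_le]; constructor <;> linarith
  · intro j hj
    apply le_antisymm
    · have e1 : Φ (D.v j) ≤ I (D.v j) := min_le_right _ _
      have e2 := hIle (D.v j) j hj
      rw [dist_self D.hc] at e2
      linarith
    · apply le_min
      · linarith [h1 j hj]
      · apply hleI
        intro i hi
        have e : |D.C j - D.C i| ≤ dist G c (D.v i) (D.v j) := by
          obtain ⟨q⟩ : Nonempty (G.Walk (D.v i) (D.v j)) := by
            obtain ⟨q⟩ := D.exA hj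
            obtain ⟨q'⟩ := D.exA hi
            exact ⟨q'.reverse.append q⟩
          exact le_dist q (fun p => D.f1 hi hj p)
        have e' := abs_le.1 e
        rcases le_total i j with hij | hij
        · have := hφ i j hij hj
          linarith [e'.1, le_abs_self (D.C j - D.C i)]
        · have := hφ j i hij hi
          linarith [dist_nonneg (G := G) D.hc (D.v i) (D.v j)]
  · have e1 : Φ s1 ≤ 0 := (min_le_left _ _).trans (by rw [dist_self D.hc])
    have e2 : wsum c D.A1 + wsum c D.B1 + φ D.k ≤ Φ t1 := by
      apply le_min
      · linarith
      · apply hleI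
        intro j hj
        linarith [h2 j hj]
    linarith

lemma pots {h : V} (hG : Deg2 G h) :
    ∃ (Φ1 Φ2 : V → ℝ) (φ : ℕ → ℝ), φ 0 = 0 ∧
      (∀ i j, i ≤ j → j ≤ D.k → 0 ≤ φ j - φ i ∧ φ j - φ i ≤ D.C j - D.C i) ∧
      (∀ a b, G.Adj a b → |Φ1 a - Φ1 b| ≤ c s(a, b)) ∧
      (∀ a b, G.Adj a b → |Φ2 a - Φ2 b| ≤ c s(a, b)) ∧
      (∀ j, j ≤ D.k → Φ1 (D.v j) = wsum c D.A1 + φ j) ∧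
      (∀ j, j ≤ D.k → Φ2 (D.v j) = wsum c D.A2 + (D.C j - φ j)) ∧
      wsum c D.A1 + wsum c D.B1 + φ D.k ≤ Φ1 t1 - Φ1 s1 ∧
      wsum c D.A2 + wsum c D.B2 + (D.C D.k - φ D.k) ≤ Φ2 t2 - Φ2 s2 := by
  have hT : D.T = wsum c D.A1 + wsum c D.B1 + wsum c D.A2 + wsum c D.B2 + D.C D.k := rfl
  have x1 : ∀ {y}, y ≤ D.k → Nonempty (G.Walk s1 (D.v y)) := fun hy => D.exA hy
  have x2 : ∀ {y}, y ≤ D.k → Nonempty (G.Walk s2 (D.v y)) := fun hy => D.swap.exA hy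
  have x3 : ∀ {y}, y ≤ D.k → Nonempty (G.Walk (D.v y) t1) := fun hy => D.exB hy
  have x4 : ∀ {y}, y ≤ D.k → Nonempty (G.Walk (D.v y) t2) := fun hy => D.swap.exB hy
  have x5 : Nonempty (G.Walk s1 t1) := D.exQ
  have x6 : Nonempty (G.Walk s2 t2) := D.swap.exQ
  have dA1 : dist G c s1 (D.v 0) = wsum c D.A1 := D.distA
  have dA2 : dist G c s2 (D.v 0) = wsum c D.A2 := D.swap.distA
  have dB1 : dist G c (D.v D.k) t1 = wsum c D.B1 := D.distB
  have dB2 : dist G c (D.v D.k) t2 = wsum c D.B2 := D.swap.distB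
  obtain ⟨φ, p0, p1, p2, p3, p4, p5⟩ := lp D.k D.C
    (fun y => dist G c s1 (D.v y) - wsum c D.A1) (fun y => dist G c s2 (D.v y) - wsum c D.A2)
    (fun x => dist G c (D.v x) t1 - wsum c D.B1) (fun x => dist G c (D.v x) t2 - wsum c D.B2)
    (dist G c s1 t1 - (wsum c D.A1 + wsum c D.B1)) (dist G c s2 t2 - (wsum c D.A2 + wsum c D.B2))
    D.C_zero (fun i j hij _ => D.C_mono hij) (by rw [dA1, sub_self]) (by rw [dA2, sub_self])
    (by rw [dB1, sub_self]) (by rw [dB2, sub_self])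
    (by
      intro i j hi hj
      have : wsum c D.A1 + wsum c D.A2 + D.C (min i j) ≤
          dist G c s1 (D.v i) + dist G c s2 (D.v j) := by
        refine le_dist_add (x1 hi).some fun p => ?_
        rw [add_comm (wsum c p)]
        refine le_dist_add (x2 hj).some fun q => ?_
        linarith [D.f3A hi hj p q]
      linarith)
    (by
      intro i j hi hj
      have : wsum c D.B1 + wsum c D.B2 + (D.C D.k - D.C (max i j)) ≤
          dist G c (D.v i) t1 + dist G c (D.v j) t2 := by
        refine le_dist_add (x3 hi).some fun p => ?_
        rw [add_comm (wsum c p)]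
        refine le_dist_add (x4 hj).some fun q => ?_
        linarith [D.f3B hi hj p q]
      linarith)
    (by
      have : D.T ≤ dist G c s1 t1 + dist G c s2 t2 := by
        refine le_dist_add x5.some fun p => ?_
        rw [add_comm (wsum c p)]
        refine le_dist_add x6.some fun q => ?_
        linarith [D.f4 p q]
      linarith)
    (by
      intro x y hx hy
      have : D.T ≤ dist G c s1 t1 + (dist G c s2 (D.v y) + (dist G c (D.v x) t2 +
          max (D.C x - D.C y) 0)) := by
        refine le_dist_add x5.some fun p => ?_
        rw [add_left_comm]
        refine le_dist_add (x2 hy).some fun q => ?_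
        rw [add_left_comm (wsum c p), add_left_comm (wsum c q)]
        refine le_dist_add (x4 hx).some fun r => ?_
        have := D.swap.Dr hG hx hy q r p
        rw [swap_T] at this
        have this' : D.T ≤ wsum c q + wsum c r + max (D.C x - D.C y) 0 + wsum c p := this
        linarith
      linarith)
    (by
      intro x y hx hy
      have : D.T ≤ dist G c s2 t2 + (dist G c s1 (D.v y) + (dist G c (D.v x) t1 +
          max (D.C x - D.C y) 0)) := by
        refine le_dist_add x6.some fun p => ?_
        rw [add_left_comm]
        refine le_dist_add (x1 hy).some fun q => ?_
        rw [add_left_comm (wsum c p), add_left_comm (wsum c q)]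
        refine le_dist_add (x3 hx).some fun r => ?_
        have := D.Dr hG hx hy q r p
        linarith
      linarith)
    (by
      intro x y x' y' hx hy hx' hy'
      have : D.T ≤ dist G c s1 (D.v y) + (dist G c (D.v x) t1 + (dist G c s2 (D.v y') +
          (dist G c (D.v x') t2 + (max (D.C x - D.C y) 0 + max (D.C x' - D.C y') 0)))) := by
        refine le_dist_add (x1 hy).some fun p => ?_
        rw [add_left_comm]
        refine le_dist_add (x3 hx).some fun q => ?_
        rw [add_left_comm (wsum c p), add_left_comm (wsum c q)]
        refine le_dist_add (x2 hy').some fun r => ?_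
        rw [add_left_comm (wsum c p), add_left_comm (wsum c q), add_left_comm (wsum c r)]
        refine le_dist_add (x4 hx').some fun z => ?_
        have := D.DD hG hx hy hx' hy' p q r z
        linarith
      linarith)
  obtain ⟨Φ1, q1, q2, q3⟩ := D.pot_exists φ p1 (fun y hy => (p2 y hy).1) (fun x hx => (p3 x hx).1) p4
  obtain ⟨Φ2, r1, r2, r3⟩ := D.swap.pot_exists (fun j => D.C j - φ j)
    (fun i j hij hj => by
      have := p1 i j hij hj
      rw [swap_C, swap_C]
      constructor <;> linarith)
    (fun y hy => (p2 y hy).2) (fun x hx => (p3 x hx).2) p5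
  exact ⟨Φ1, Φ2, φ, p0, p1, q1, r1, q2, r2, q3, r3⟩

end Cfg


section assembly
variable {G : SimpleGraph V} {c : Sym2 V → ℝ} {F : Finset (Sym2 V)}

lemma Cs_walk (f : Sym2 V → ℝ) {u w : V} (p : G.Walk u w) :
    Cs f p.getVert p.length = wsum f p := by
  induction p with
  | nil => simp
  | @cons a b d h p ih =>
    rw [wsum_cons, ← ih]
    unfold Cs
    rw [SimpleGraph.Walk.length_cons, Finset.sum_range_succ', add_comm]
    simp

lemma mem_edges_getVert {u w : V} (p : G.Walk u w) {e : Sym2 V} (he : e ∈ p.edges) :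
    ∃ j, j < p.length ∧ e = s(p.getVert j, p.getVert (j + 1)) := by
  induction p with
  | nil => simp at he
  | @cons a b d h p ih =>
    rw [SimpleGraph.Walk.edges_cons, List.mem_cons] at he
    rcases he with rfl | he
    · exact ⟨0, by simp, by simp⟩
    · obtain ⟨j, hj, rfl⟩ := ih he
      exact ⟨j + 1, by simpa using hj, by simp⟩

lemma wsum_mono {f g : Sym2 V → ℝ} {u w : V} (p : G.Walk u w) (h : ∀ e ∈ p.edges, f e ≤ g e) :
    wsum f p ≤ wsum g p := List.sum_le_sum h

lemma wsum_congr {f g : Sym2 V → ℝ} {u w : V} (p : G.Walk u w) (h : ∀ e ∈ p.edges, f e = g e) :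
    wsum f p = wsum g p := le_antisymm (wsum_mono p fun e he => (h e he).le)
      (wsum_mono p fun e he => (h e he).ge)

lemma edge_disj {u w u' w' a : V} (p : G.Walk u w) (q : G.Walk u' w')
    (h : ∀ z, z ∈ p.support → z ∈ q.support → z = a) (e : Sym2 V) (hp : e ∈ p.edges)
    (hq : e ∈ q.edges) : False := by
  induction e using Sym2.ind with
  | _ x y =>
    have h1 := h x (p.fst_mem_support_of_mem_edges hp) (q.fst_mem_support_of_mem_edges hq)
    have h2 := h y (p.snd_mem_support_of_mem_edges hp) (q.snd_mem_support_of_mem_edges hq)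
    have : G.Adj x y := p.edges_subset_edgeSet hp
    exact this.ne (h1.trans h2.symm)

/-- The data needed for enforceability. -/
def Ready (c : Sym2 V → ℝ) {s₁ t₁ s₂ t₂ : V} (P₁ : G.Walk s₁ t₁) (P₂ : G.Walk s₂ t₂) : Prop :=
  ∃ Φ₁ Φ₂ : V → ℝ, (∀ a b, G.Adj a b → |Φ₁ a - Φ₁ b| ≤ c s(a, b)) ∧
    (∀ a b, G.Adj a b → |Φ₂ a - Φ₂ b| ≤ c s(a, b)) ∧
    (∀ e, e ∈ P₁.edges → e ∈ P₂.edges → absd Φ₁ e + absd Φ₂ e = c e) ∧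
    (wsum (fun e => if e ∈ P₂.edges then absd Φ₁ e else c e) P₁ ≤ Φ₁ t₁ - Φ₁ s₁) ∧
    (wsum (fun e => if e ∈ P₁.edges then absd Φ₂ e else c e) P₂ ≤ Φ₂ t₂ - Φ₂ s₂)

lemma absd_neg (Φ : V → ℝ) (e : Sym2 V) : absd (fun v => - Φ v) e = absd Φ e := by
  induction e using Sym2.ind with
  | _ x y =>
    simp only [absd_mk]
    rw [← abs_neg]; congr 1; ring

lemma Ready.reverse {s₁ t₁ s₂ t₂ : V} {P₁ : G.Walk s₁ t₁} {P₂ : G.Walk s₂ t₂}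
    (h : Ready c P₁ P₂.reverse) : Ready c P₁ P₂ := by
  obtain ⟨Φ₁, Φ₂, h1, h2, h3, h4, h5⟩ := h
  refine ⟨Φ₁, fun v => - Φ₂ v, h1, ?_, ?_, ?_, ?_⟩
  · intro a b hab
    have := h2 a b hab
    rw [← absd_mk] at this ⊢
    rwa [absd_neg]
  · intro e he he'
    rw [absd_neg]
    exact h3 e he (by simpa using he')
  · simpa using h4
  · simp only [absd_neg]
    rw [wsum_reverse] at h5
    linarith

lemma decomp_ready {h : V} (hG : Deg2 G h) (hc : ∀ e, 0 ≤ c e) {s1 t1 s2 t2 a b : V}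
    (opt : ∀ L, R G L s1 t1 → R G L s2 t2 → cost c F ≤ (L.map c).sum)
    (A1 : G.Walk s1 a) (S : G.Walk a b) (B1 : G.Walk b t1)
    (A2 : G.Walk s2 a) (B2 : G.Walk b t2)
    (hP1 : (A1.append (S.append B1)).IsPath) (hP2 : (A2.append (S.append B2)).IsPath)
    (hF1 : ∀ e ∈ (A1.append (S.append B1)).edges, e ∈ F)
    (hF2 : ∀ e ∈ (A2.append (S.append B2)).edges, e ∈ F)
    (hA1 : ∀ z, z ∈ A1.support → z ∈ (A2.append (S.append B2)).support → z = a)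
    (hB1 : ∀ z, z ∈ B1.support → z ∈ (A2.append (S.append B2)).support → z = b) :
    Ready c (A1.append (S.append B1)) (A2.append (S.append B2)) := by
  have hS : S.IsPath := hP1.of_append_right.of_append_left
  have hP2' : ((A2.append S).append B2).IsPath := by
    rwa [← SimpleGraph.Walk.append_assoc]
  have hinj : ∀ i j, i ≤ S.length → j ≤ S.length → S.getVert i = S.getVert j → i = j :=
    fun i j hi hj hij => hS.getVert_injOn hi hj hij
  have hab : a = b → S.length = 0 := by
    intro hab
    exact (hinj 0 _ (Nat.zero_le _) le_rfl (by simpa using hab)).symm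
  have m1 : ∀ z, z ∈ A2.support → z ∈ (A2.append (S.append B2)).support := fun z hz => by
    rw [SimpleGraph.Walk.mem_support_append_iff]; exact Or.inl hz
  have m2 : ∀ z, z ∈ S.support → z ∈ (A2.append (S.append B2)).support := fun z hz => by
    rw [SimpleGraph.Walk.mem_support_append_iff, SimpleGraph.Walk.mem_support_append_iff]
    exact Or.inr (Or.inl hz)
  have m3 : ∀ z, z ∈ B2.support → z ∈ (A2.append (S.append B2)).support := fun z hz => by
    rw [SimpleGraph.Walk.mem_support_append_iff, SimpleGraph.Walk.mem_support_append_iff]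
    exact Or.inr (Or.inr hz)
  have iA2 : ∀ z, z ∈ A2.support → z ∈ S.support → z = a := fun z hz hz' =>
    path_append_inter _ _ hP2 hz (by
      rw [SimpleGraph.Walk.mem_support_append_iff]; exact Or.inl hz')
  have iB2 : ∀ z, z ∈ S.support → z ∈ B2.support → z = b := fun z hz hz' =>
    path_append_inter _ _ hP2' (by
      rw [SimpleGraph.Walk.mem_support_append_iff]; exact Or.inr hz) hz'
  have toA : ∀ j, j ≤ S.length → S.getVert j = a → j = 0 := fun j hj h =>
    hinj j 0 hj (Nat.zero_le _) (by simpa using h)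
  have toB : ∀ j, j ≤ S.length → S.getVert j = b → j = S.length := fun j hj h =>
    hinj j _ hj le_rfl (by simpa using h)
  have shared : ∀ e, e ∈ (A1.append (S.append B1)).edges → e ∈ (A2.append (S.append B2)).edges →
      e ∈ S.edges := by
    intro e he he'
    rw [SimpleGraph.Walk.edges_append, SimpleGraph.Walk.edges_append, List.mem_append,
      List.mem_append] at he
    rcases he with he | he | he
    · exact (edge_disj _ _ hA1 e he he').elim
    · exact he
    · exact (edge_disj _ _ hB1 e he he').elim
  have hcost : wsum c A1 + wsum c B1 + wsum c A2 + wsum c B2 + wsum c S ≤ cost c F := by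
    have n1 := hP1.isTrail.edges_nodup
    have n2 := hP2.isTrail.edges_nodup
    have n3 : (A2.edges ++ B2.edges).Nodup := by
      refine List.Nodup.sublist ?_ n2
      rw [SimpleGraph.Walk.edges_append, SimpleGraph.Walk.edges_append]
      exact (List.Sublist.refl _).append (List.sublist_append_right _ _)
    have n4 : ((A1.append (S.append B1)).edges ++ (A2.edges ++ B2.edges)).Nodup := by
      rw [List.nodup_append]
      refine ⟨n1, n3, ?_⟩
      rintro e he e' he' rfl
      have he2 : e ∈ (A2.append (S.append B2)).edges := by
        rw [SimpleGraph.Walk.edges_append, SimpleGraph.Walk.edges_append]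
        rw [List.mem_append] at he'
        rcases he' with h | h <;> simp [h]
      have hs := shared e he he2
      rw [List.mem_append] at he'
      rcases he' with h | h
      · exact edge_disj _ _ iA2 e h hs
      · exact edge_disj _ _ iB2 e hs h
    have e1 : (((A1.append (S.append B1)).edges ++ (A2.edges ++ B2.edges)).map c).sum
        ≤ cost c F := by
      rw [← List.sum_toFinset _ n4]
      apply Finset.sum_le_sum_of_subset_of_nonneg _ (fun e _ _ => hc e)
      intro e he
      rw [List.mem_toFinset, List.mem_append] at he
      rcases he with he | he
      · exact hF1 e he
      · apply hF2
        rw [SimpleGraph.Walk.edges_append, SimpleGraph.Walk.edges_append]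
        rw [List.mem_append] at he
        rcases he with h | h <;> simp [h]
    simp only [SimpleGraph.Walk.edges_append, List.map_append, List.sum_append] at e1
    simp only [wsum]
    linarith
  obtain ⟨D, dk, dv, dA1, dB1, dA2, dB2⟩ : ∃ D : Cfg G c s1 t1 s2 t2, D.k = S.length ∧
      D.v = S.getVert ∧ wsum c D.A1 = wsum c A1 ∧ wsum c D.B1 = wsum c B1 ∧
      wsum c D.A2 = wsum c A2 ∧ wsum c D.B2 = wsum c B2 := by
    refine ⟨{
      k := S.length
      v := S.getVert
      a := a
      b := b
      ha := by simp
      hb := by simp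
      adj := fun j hj => S.adj_getVert_succ hj
      inj := hinj
      A1 := A1
      B1 := B1
      A2 := A2
      B2 := B2
      pA1 := hP1.of_append_left
      pB1 := hP1.of_append_right.of_append_right
      pA2 := hP2.of_append_left
      pB2 := hP2.of_append_right.of_append_right
      vA1 := fun j hj hz => toA j hj (hA1 _ hz (m2 _ (S.getVert_mem_support j)))
      vA2 := fun j hj hz => toA j hj (iA2 _ hz (S.getVert_mem_support j))
      vB1 := fun j hj hz => toB j hj (hB1 _ hz (m2 _ (S.getVert_mem_support j)))
      vB2 := fun j hj hz => toB j hj (iB2 _ (S.getVert_mem_support j) hz)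
      AA := fun x hx hx' => hA1 x hx (m1 x hx')
      BB := fun x hx hx' => hB1 x hx (m3 x hx')
      AB := fun h0 x hx hx' => by
        have e1 := hA1 x hx (m3 x hx')
        subst e1
        exact h0 (hab (iB2 _ S.start_mem_support hx'))
      BA := fun h0 x hx hx' => by
        have e1 := hB1 x hx' (m1 x hx)
        subst e1
        exact h0 (hab (iA2 _ hx S.end_mem_support).symm)
      hc := hc
      opt := fun L h1 h2 => by
        rw [Cs_walk]
        exact hcost.trans (opt L h1 h2) }, rfl, rfl, rfl, rfl, rfl, rfl⟩
  obtain ⟨Φ1, Φ2, φ, p0, p1, l1, l2, v1, v2, q1, q2⟩ := D.pots hG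
  have hC : ∀ j, D.C j = Cs c S.getVert j := fun j => by rw [Cfg.C, dv]
  rw [dA1, dB1] at q1
  rw [dA2, dB2] at q2
  rw [dk] at p1 v1 v2 q1 q2
  rw [dv] at v1 v2
  have step : ∀ j, j < S.length →
      absd Φ1 s(S.getVert j, S.getVert (j + 1)) = φ (j + 1) - φ j ∧
      absd Φ2 s(S.getVert j, S.getVert (j + 1)) =
        (D.C (j + 1) - φ (j + 1)) - (D.C j - φ j) := by
    intro j hj
    have hp := p1 j (j + 1) (by omega) (by omega)
    simp only [absd_mk]
    rw [v1 j (by omega), v1 (j + 1) (by omega), v2 j (by omega), v2 (j + 1) (by omega)]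
    constructor
    · rw [abs_sub_comm, abs_of_nonneg (by linarith)]; ring
    · rw [abs_sub_comm, abs_of_nonneg (by linarith)]; ring
  have S1 : wsum (absd Φ1) S = φ S.length := by
    rw [← Cs_walk]
    unfold Cs
    rw [Finset.sum_congr rfl (fun j hj => (step j (Finset.mem_range.1 hj)).1),
      Finset.sum_range_sub, p0, sub_zero]
  have S2 : wsum (absd Φ2) S = D.C S.length - φ S.length := by
    rw [← Cs_walk]
    unfold Cs
    rw [Finset.sum_congr rfl (fun j hj => (step j (Finset.mem_range.1 hj)).2),
      Finset.sum_range_sub (fun j => D.C j - φ j), p0, D.C_zero]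
    ring
  have ll1 : ∀ e ∈ G.edgeSet, absd Φ1 e ≤ c e := by
    intro e he
    induction e using Sym2.ind with
    | _ x y => exact l1 x y he
  have ll2 : ∀ e ∈ G.edgeSet, absd Φ2 e ≤ c e := by
    intro e he
    induction e using Sym2.ind with
    | _ x y => exact l2 x y he
  refine ⟨Φ1, Φ2, l1, l2, ?_, ?_, ?_⟩
  · intro e he he'
    obtain ⟨j, hj, rfl⟩ := mem_edges_getVert S (shared e he he')
    rw [(step j hj).1, (step j hj).2, hC, hC, Cs_succ]
    ring
  · refine le_trans ?_ q1
    simp only [wsum_append]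
    have g : ∀ {u w : V} (p : G.Walk u w),
        wsum (fun e => if e ∈ (A2.append (S.append B2)).edges then absd Φ1 e else c e) p
          ≤ wsum c p := by
      intro u w p
      apply wsum_mono
      intro e he
      have := ll1 e (p.edges_subset_edgeSet he)
      split_ifs <;> linarith
    have g2 : wsum (fun e => if e ∈ (A2.append (S.append B2)).edges then absd Φ1 e else c e) S
          = wsum (absd Φ1) S := by
      apply wsum_congr
      intro e he
      rw [if_pos]
      simp [he]
    linarith [g A1, g B1]
  · refine le_trans ?_ q2
    simp only [wsum_append]
    have g : ∀ {u w : V} (p : G.Walk u w),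
        wsum (fun e => if e ∈ (A1.append (S.append B1)).edges then absd Φ2 e else c e) p
          ≤ wsum c p := by
      intro u w p
      apply wsum_mono
      intro e he
      have := ll2 e (p.edges_subset_edgeSet he)
      split_ifs <;> linarith
    have g2 : wsum (fun e => if e ∈ (A1.append (S.append B1)).edges then absd Φ2 e else c e) S
          = wsum (absd Φ2) S := by
      apply wsum_congr
      intro e he
      rw [if_pos]
      simp [he]
    linarith [g A2, g B2]

lemma main_ready {h : V} (hG : Deg2 G h) (hc : ∀ e, 0 ≤ c e)
    (hF : (SimpleGraph.fromEdgeSet (↑F : Set (Sym2 V))).IsAcyclic) {s1 t1 s2 t2 a b : V}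
    (opt : ∀ L, R G L s1 t1 → R G L s2 t2 → cost c F ≤ (L.map c).sum)
    (A1 : G.Walk s1 a) (S : G.Walk a b) (B1 : G.Walk b t1) (P2 : G.Walk s2 t2)
    (hP1 : (A1.append (S.append B1)).IsPath) (hP2 : P2.IsPath)
    (hF1 : ∀ e ∈ (A1.append (S.append B1)).edges, e ∈ F)
    (hF2 : ∀ e ∈ P2.edges, e ∈ F)
    (hA1 : ∀ z, z ∈ A1.support → z ∈ P2.support → z = a)
    (hB1 : ∀ z, z ∈ B1.support → z ∈ P2.support → z = b)
    (ha : a ∈ P2.support) (hb : b ∈ (P2.dropUntil a ha).support) :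
    Ready c (A1.append (S.append B1)) P2 := by
  have e1 : P2 = (P2.takeUntil a ha).append
      (((P2.dropUntil a ha).takeUntil b hb).append ((P2.dropUntil a ha).dropUntil b hb)) := by
    rw [SimpleGraph.Walk.take_spec, SimpleGraph.Walk.take_spec]
  generalize P2.takeUntil a ha = A2 at e1
  generalize (P2.dropUntil a ha).takeUntil b hb = S2 at e1
  generalize (P2.dropUntil a ha).dropUntil b hb = B2 at e1
  subst e1
  have hS2 : S2 = S := by
    apply uniq_in hF _ _ hP2.of_append_right.of_append_left hP1.of_append_right.of_append_left
    · intro e he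
      exact hF2 e (by simp [he])
    · intro e he
      exact hF1 e (by simp [he])
  subst hS2
  exact decomp_ready hG hc opt A1 S2 B1 A2 B2 hP1 hP2 hF1 hF2 hA1 hB1

theorem strong {h : V} (hG : Deg2 G h) (s₁ t₁ s₂ t₂ : V) : StronglyEfficient G s₁ t₁ s₂ t₂ := by
  intro c hc F hF
  obtain ⟨P₁, hP₁, hF₁⟩ := hF.1.2.2.1
  obtain ⟨P₂, hP₂, hF₂⟩ := hF.1.2.2.2
  by_cases hmeet : ∃ z ∈ P₁.support, z ∈ P₂.support
  swap
  · apply enf_disjoint hc hF P₁ P₂ hP₁ hP₂ hF₁ hF₂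
    exact edge_disj (a := s₁) P₁ P₂ (fun z h1 h2 => (hmeet ⟨z, h1, h2⟩).elim)
  obtain ⟨a, A1, R1, rfl, ha, hA1⟩ := split_first (fun z => z ∈ P₂.support) P₁ hmeet
  obtain ⟨b, B1, S, hR, hb, hB1⟩ := split_first (fun z => z ∈ P₂.support) R1.reverse
    ⟨a, R1.reverse.end_mem_support, ha⟩
  have hR1 : R1 = S.reverse.append B1.reverse := by
    rw [← SimpleGraph.Walk.reverse_append, ← hR, SimpleGraph.Walk.reverse_reverse]
  subst hR1
  have hB1' : ∀ z, z ∈ B1.reverse.support → z ∈ P₂.support → z = b := by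
    intro z hz
    exact hB1 z (by simpa using hz)
  have ready : Ready c (A1.append (S.reverse.append B1.reverse)) P₂ := by
    by_cases hbd : b ∈ (P₂.dropUntil a ha).support
    · exact main_ready hG hc hF.1.2.1 (fun L h1 h2 => opt_le hc hF L h1 h2) A1 S.reverse B1.reverse
        P₂ hP₁ hP₂ hF₁ hF₂ hA1 hB1' ha hbd
    · apply Ready.reverse
      have ha' : a ∈ P₂.reverse.support := by simpa using ha
      refine main_ready hG hc hF.1.2.1 (fun L h1 h2 => opt_le hc hF L h1 h2.symm) A1 S.reverse
        B1.reverse P₂.reverse hP₁ hP₂.reverse hF₁ (by simpa using hF₂) (by simpa using hA1)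
        (by simpa using hB1') ha' ?_
      by_contra hcon
      have hb' : b ∈ P₂.reverse.support := by simpa using hb
      have k1 : b ∈ (P₂.takeUntil a ha).support := by
        rw [← P₂.take_spec ha, SimpleGraph.Walk.mem_support_append_iff] at hb
        exact hb.resolve_right hbd
      have e1 : P₂.reverse = (P₂.dropUntil a ha).reverse.append (P₂.takeUntil a ha).reverse := by
        rw [← SimpleGraph.Walk.reverse_append, P₂.take_spec ha]
      have k2 : b ∈ (P₂.reverse.takeUntil a ha').support := by
        rw [← P₂.reverse.take_spec ha', SimpleGraph.Walk.mem_support_append_iff] at hb'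
        exact hb'.resolve_right hcon
      have e2 : (P₂.dropUntil a ha).reverse = P₂.reverse.takeUntil a ha' := by
        apply uniq_in hF.1.2.1
        · exact (hP₂.dropUntil ha).reverse
        · exact hP₂.reverse.takeUntil ha'
        · intro e he
          exact hF₂ e (P₂.edges_dropUntil_subset_edges ha (by simpa using he))
        · intro e he
          have := P₂.reverse.edges_takeUntil_subset_edges ha' he
          exact hF₂ e (by simpa using this)
      rw [← e2] at k2
      exact hbd (by simpa using k2)
  obtain ⟨Φ₁, Φ₂, h1, h2, h3, h4, h5⟩ := ready
  exact enf hc hF.1.2.1 _ _ hP₁ hP₂ hF₁ hF₂ Φ₁ Φ₂ h1 h2 h3 h4 h5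

end assembly

section wheels

lemma succ_mod_inj {n i j : ℕ} (hi : i < n) (hj : j < n) (h : (i + 1) % n = (j + 1) % n) :
    i = j := by
  by_cases h1 : i + 1 = n <;> by_cases h2 : j + 1 = n
  · omega
  · rw [h1, Nat.mod_self, Nat.mod_eq_of_lt (by omega)] at h; omega
  · rw [h2, Nat.mod_self, Nat.mod_eq_of_lt (by omega)] at h; omega
  · rw [Nat.mod_eq_of_lt (by omega), Nat.mod_eq_of_lt (by omega)] at h; omega

lemma deg2_of_rel {n : ℕ} (r : Fin n → Fin n → Prop)
    (h1 : ∀ i j j', r i j → r i j' → j = j') (h2 : ∀ i j j', r j i → r j' i → j = j')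
    (G : SimpleGraph (Option (Fin n)))
    (hG : ∀ i j, G.Adj (some i) (some j) → r i j ∨ r j i) : Deg2 G none := by
  intro v x y z hv hx hy hz
  obtain ⟨v, rfl⟩ := Option.ne_none_iff_exists'.1 hv
  obtain ⟨x, rfl⟩ := Option.ne_none_iff_exists'.1 hx
  obtain ⟨y, rfl⟩ := Option.ne_none_iff_exists'.1 hy
  obtain ⟨z, rfl⟩ := Option.ne_none_iff_exists'.1 hz
  intro a1 a2 a3 n1 n2 n3
  have n1 : x ≠ y := fun h => n1 (by rw [h])
  have n2 : x ≠ z := fun h => n2 (by rw [h])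
  have n3 : y ≠ z := fun h => n3 (by rw [h])
  rcases hG _ _ a1 with a1 | a1 <;> rcases hG _ _ a2 with a2 | a2 <;>
    rcases hG _ _ a3 with a3 | a3 <;>
    first
    | exact n1 (h1 _ _ _ a1 a2)
    | exact n2 (h1 _ _ _ a1 a3)
    | exact n3 (h1 _ _ _ a2 a3)
    | exact n1 (h2 _ _ _ a1 a2)
    | exact n2 (h2 _ _ _ a1 a3)
    | exact n3 (h2 _ _ _ a2 a3)

lemma deg2_wheel (n : ℕ) : Deg2 (wheelGraph n) none := by
  apply deg2_of_rel (fun i j => (i.val + 1) % n = j.val)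
  · intro i j j' h h'
    exact Fin.ext (h.symm.trans h')
  · intro i j j' h h'
    exact Fin.ext (succ_mod_inj j.2 j'.2 (h.trans h'.symm))
  · intro i j hij
    simp only [wheelGraph, SimpleGraph.fromRel_adj] at hij
    simpa using hij.2

lemma deg2_fan (n : ℕ) : Deg2 (fanGraph n) none := by
  apply deg2_of_rel (fun i j => i.val + 1 = j.val)
  · intro i j j' h h'
    exact Fin.ext (h.symm.trans h')
  · intro i j j' h h'
    apply Fin.ext; omega
  · intro i j hij
    simp only [fanGraph, SimpleGraph.fromRel_adj] at hij
    simpa using hij.2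

end wheels
/-- Every wheel graph and every fan graph is strongly
efficient for every placement of the terminal pairs: for every nonnegative
cost function, every optimal Steiner forest of the induced two-player network
design game is enforceable. -/
theorem wheel_and_fan_strongly_efficient (n : ℕ) :
    (∀ s₁ t₁ s₂ t₂ : Option (Fin n), StronglyEfficient (wheelGraph n) s₁ t₁ s₂ t₂) ∧
    (∀ s₁ t₁ s₂ t₂ : Option (Fin (n + 1)), StronglyEfficient (fanGraph n) s₁ t₁ s₂ t₂) := by
  exact ⟨fun s₁ t₁ s₂ t₂ => strong (deg2_wheel n) s₁ t₁ s₂ t₂,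
    fun s₁ t₁ s₂ t₂ => strong (deg2_fan n) s₁ t₁ s₂ t₂⟩

end NDG
end
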